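/- Case 10 of Theorem 1.2: the hypergeometric group Γ(f,g) generated by the companion matrices A and B of f(x) = x^5 - x^4 + x^3 - x^2 + x - 1 and g(x) = x^5 + x^4 + 2x^3 + 2x^2 + x + 1 is an arithmetic subgroup of the integral orthogonal group O_Q(ℤ): Γ(f,g) is contained in O_Q(ℤ) (in particular Aᵀ·Q·A = Q and Bᵀ·Q·B = Q), and Γ(f,g) has finite index in O_Q(ℤ). -/

import Mathlib

open Matrix

/-- The companion matrix `A` of `f(x) = x^5 - x^4 + x^3 - x^2 + x - 1`. -/
def matA : Matrix (Fin 5) (Fin 5) ℤ :=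
  !![(0 : ℤ), 0, 0, 0, 1; 1, 0, 0, 0, -1; 0, 1, 0, 0, 1; 0, 0, 1, 0, -1; 0, 0, 0, 1, 1]

/-- The companion matrix `B` of `g(x) = x^5 + x^4 + 2*x^3 + 2*x^2 + x + 1`. -/
def matB : Matrix (Fin 5) (Fin 5) ℤ :=
  !![(0 : ℤ), 0, 0, 0, -1; 1, 0, 0, 0, -1; 0, 1, 0, 0, -2; 0, 0, 1, 0, -2; 0, 0, 0, 1, -1]

/-- The symmetric integer matrix `Q` of the quadratic form preserved by `Γ(f,g)`. -/
def matQ : Matrix (Fin 5) (Fin 5) ℤ :=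
  !![(1 : ℤ), -7, 1, 17, 1; -7, 1, -7, 1, 17; 1, -7, 1, -7, 1; 17, 1, -7, 1, -7; 1, 17, 1, -7, 1]

/-- The integral orthogonal group `O_Q(ℤ)` of a matrix `Q`, as the subgroup of `GL₅(ℤ)`
consisting of all `M` with `Mᵀ * Q * M = Q`. -/
def orthogonalSubgroup (Q : Matrix (Fin 5) (Fin 5) ℤ) : Subgroup (GL (Fin 5) ℤ) where
  carrier := { M : GL (Fin 5) ℤ |
      (M : Matrix (Fin 5) (Fin 5) ℤ)ᵀ * Q * (M : Matrix (Fin 5) (Fin 5) ℤ) = Q }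
  one_mem' := by simp
  mul_mem' := by
    intro a b ha hb
    simp only [Set.mem_setOf_eq, Units.val_mul, transpose_mul] at ha hb ⊢
    calc ((b : Matrix (Fin 5) (Fin 5) ℤ)ᵀ * (a : Matrix (Fin 5) (Fin 5) ℤ)ᵀ) * Q *
          ((a : Matrix (Fin 5) (Fin 5) ℤ) * (b : Matrix (Fin 5) (Fin 5) ℤ))
        = (b : Matrix (Fin 5) (Fin 5) ℤ)ᵀ *
            ((a : Matrix (Fin 5) (Fin 5) ℤ)ᵀ * Q * (a : Matrix (Fin 5) (Fin 5) ℤ)) *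
            (b : Matrix (Fin 5) (Fin 5) ℤ) := by
          simp only [mul_assoc]
      _ = Q := by rw [ha, hb]
  inv_mem' := by
    intro a ha
    simp only [Set.mem_setOf_eq] at ha ⊢
    calc ((a⁻¹ : GL (Fin 5) ℤ) : Matrix (Fin 5) (Fin 5) ℤ)ᵀ * Q *
          ((a⁻¹ : GL (Fin 5) ℤ) : Matrix (Fin 5) (Fin 5) ℤ)
        = ((a⁻¹ : GL (Fin 5) ℤ) : Matrix (Fin 5) (Fin 5) ℤ)ᵀ *
            ((a : Matrix (Fin 5) (Fin 5) ℤ)ᵀ * Q * (a : Matrix (Fin 5) (Fin 5) ℤ)) *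
            ((a⁻¹ : GL (Fin 5) ℤ) : Matrix (Fin 5) (Fin 5) ℤ) := by rw [ha]
      _ = ((a : Matrix (Fin 5) (Fin 5) ℤ) *
            ((a⁻¹ : GL (Fin 5) ℤ) : Matrix (Fin 5) (Fin 5) ℤ))ᵀ * Q *
          ((a : Matrix (Fin 5) (Fin 5) ℤ) *
            ((a⁻¹ : GL (Fin 5) ℤ) : Matrix (Fin 5) (Fin 5) ℤ)) := by
          simp only [transpose_mul, mul_assoc]
      _ = Q := by rw [Units.mul_inv]; simp

namespace HG

/-- 5×5 integer matrices. -/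
abbrev Mt := Matrix (Fin 5) (Fin 5) ℤ
/-- The group `GL₅(ℤ)`. -/
abbrev GLZ := GL (Fin 5) ℤ

def R0 : Mt := !![0, -1, 0, -2, 0; -1, 0, 0, -2, 0; -2, -2, 1, -4, 0; 0, 0, 0, 1, 0; 0, 0, 0, 0, 1]
def R1 : Mt := !![1, 0, 0, 0, 0; 0, 1, 0, 0, 0; 0, 0, 0, -1, 0; 0, 0, -1, 0, 0; 0, 0, 0, 0, 1]
def R2 : Mt := !![1, -1, -1, -1, 0; 0, 1, 0, 0, 0; 0, -1, 0, -1, 0; 0, -1, -1, 0, 0; 0, 0, 0, 0, 1]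
def R3 : Mt := !![8, -49, 7, -28, -168; -1, 8, -1, 4, 24; 4, -28, 5, -16, -96; -1, 7, -1, 5, 24; 1, -7, 1, -4, -23]
def R4 : Mt := !![7, -36, 6, -30, -144; -1, 7, -1, 5, 24; 5, -30, 6, -25, -120; -1, 6, -1, 6, 24; 1, -6, 1, -5, -23]
def R5 : Mt := !![0, -1, 0, -3, 0; -1, 0, 0, -3, 0; -3, -3, 1, -9, 0; 0, 0, 0, 1, 0; 0, 0, 0, 0, 1]
def mA : Mt := !![6, -8, 1, 0, -48; -1, -1, 1, -1, 0; 3, -4, 1, 0, -24; -2, 5, -1, 2, 24; 1, -1, 0, 0, -7]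
def mB : Mt := !![6, -8, 1, 0, -48; -1, -1, 1, -1, 0; 2, -5, 1, -2, -24; -3, 4, -1, 0, 24; 1, -1, 0, 0, -7]
def X : Mt := !![1, 0, 0, -1, 0; 0, 1, 0, 0, 0; 0, 1, 1, 0, 0; 0, 0, 0, 1, 0; 0, 0, 0, 0, 1]
def XI : Mt := !![1, 0, 0, 1, 0; 0, 1, 0, 0, 0; 0, -1, 1, 0, 0; 0, 0, 0, 1, 0; 0, 0, 0, 0, 1]
def E1F2 : Mt := !![1, 0, -1, 0, 0; 0, 1, 0, 0, 0; 0, 0, 1, 0, 0; 0, 1, 0, 1, 0; 0, 0, 0, 0, 1]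
def E1F2I : Mt := !![1, 0, 1, 0, 0; 0, 1, 0, 0, 0; 0, 0, 1, 0, 0; 0, -1, 0, 1, 0; 0, 0, 0, 0, 1]
def F1E2 : Mt := !![1, 0, 0, 0, 0; 0, 1, 0, -1, 0; 1, 0, 1, 0, 0; 0, 0, 0, 1, 0; 0, 0, 0, 0, 1]
def F1E2I : Mt := !![1, 0, 0, 0, 0; 0, 1, 0, 1, 0; -1, 0, 1, 0, 0; 0, 0, 0, 1, 0; 0, 0, 0, 0, 1]
def F1F2 : Mt := !![1, 0, 0, 0, 0; 0, 1, -1, 0, 0; 0, 0, 1, 0, 0; 1, 0, 0, 1, 0; 0, 0, 0, 0, 1]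
def F1F2I : Mt := !![1, 0, 0, 0, 0; 0, 1, 1, 0, 0; 0, 0, 1, 0, 0; -1, 0, 0, 1, 0; 0, 0, 0, 0, 1]
def E1W : Mt := !![1, -12, 0, 0, -24; 0, 1, 0, 0, 0; 0, 0, 1, 0, 0; 0, 0, 0, 1, 0; 0, 1, 0, 0, 1]
def E1WI : Mt := !![1, -12, 0, 0, 24; 0, 1, 0, 0, 0; 0, 0, 1, 0, 0; 0, 0, 0, 1, 0; 0, -1, 0, 0, 1]
def F1W : Mt := !![1, 0, 0, 0, 0; -12, 1, 0, 0, -24; 0, 0, 1, 0, 0; 0, 0, 0, 1, 0; 1, 0, 0, 0, 1]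
def F1WI : Mt := !![1, 0, 0, 0, 0; -12, 1, 0, 0, 24; 0, 0, 1, 0, 0; 0, 0, 0, 1, 0; -1, 0, 0, 0, 1]
def E2W : Mt := !![1, 0, 0, 0, 0; 0, 1, 0, 0, 0; 0, 0, 1, -12, -24; 0, 0, 0, 1, 0; 0, 0, 0, 1, 1]
def S1 : Mt := !![0, -1, 0, 0, 0; -1, 0, 0, 0, 0; 0, 0, 1, 0, 0; 0, 0, 0, 1, 0; 0, 0, 0, 0, 1]
def N1 : Mt := !![0, 1, 0, 0, 0; 1, 0, 0, 0, 0; 0, 0, 1, 0, 0; 0, 0, 0, 1, 0; 0, 0, 0, 0, 1]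
def N2 : Mt := !![1, 0, 0, 0, 0; 0, 1, 0, 0, 0; 0, 0, 0, 1, 0; 0, 0, 1, 0, 0; 0, 0, 0, 0, 1]
def RW : Mt := !![1, 0, 0, 0, 0; 0, 1, 0, 0, 0; 0, 0, 1, 0, 0; 0, 0, 0, 1, 0; 0, 0, 0, 0, -1]
def RHO : Mt := !![1, 0, 0, 0, 0; 0, 1, 0, 0, 0; 0, 0, 4, -3, -24; 0, 0, -3, 4, 24; 0, 0, 1, -1, -7]
def mJ : Mt := !![0, 1, 0, 0, 0; 1, 0, 0, 0, 0; 0, 0, 0, 1, 0; 0, 0, 1, 0, 0; 0, 0, 0, 0, 24]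
def PM : Mt := !![0, 0, 0, 1, 1; 1, -1, 0, 0, -7; 0, 0, 0, 0, 1; 0, -2, 1, -1, -7; 0, 1, 0, 0, 1]
def PI : Mt := !![0, 1, 6, 0, 1; 0, 0, -1, 0, 1; 1, 0, 4, 1, 2; 1, 0, -1, 0, 0; 0, 0, 1, 0, 0]
def X12 : Mt := !![1, 0, 0, -12, 0; 0, 1, 0, 0, 0; 0, 12, 1, 0, 0; 0, 0, 0, 1, 0; 0, 0, 0, 0, 1]

/-! ### Membership of integer matrices in subgroups of `GL₅(ℤ)` -/

/-- The matrix `M` is the matrix of an element of `H`. -/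
def InS (H : Subgroup GLZ) (M : Mt) : Prop := ∃ g ∈ H, (g : Mt) = M

lemma InS.one {H : Subgroup GLZ} : InS H 1 := ⟨1, H.one_mem, rfl⟩

lemma InS.mul {H : Subgroup GLZ} {M N : Mt} (hM : InS H M) (hN : InS H N) : InS H (M * N) := by
  obtain ⟨g, hg, rfl⟩ := hM
  obtain ⟨k, hk, rfl⟩ := hN
  exact ⟨g * k, H.mul_mem hg hk, rfl⟩

lemma InS.mono {H K : Subgroup GLZ} (h : H ≤ K) {M : Mt} (hM : InS H M) : InS K M := by
  obtain ⟨g, hg, rfl⟩ := hM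
  exact ⟨g, h hg, rfl⟩

lemma InS.inv {H : Subgroup GLZ} {M N : Mt} (hM : InS H M) (e : M * N = 1) : InS H N := by
  obtain ⟨g, hg, rfl⟩ := hM
  refine ⟨g⁻¹, H.inv_mem hg, ?_⟩
  calc ((g⁻¹ : GLZ) : Mt) = ((g⁻¹ : GLZ) : Mt) * ((g : Mt) * N) := by rw [e, mul_one]
    _ = N := by rw [← mul_assoc, Units.inv_mul, one_mul]

lemma InS.pow {H : Subgroup GLZ} {M : Mt} (hM : InS H M) (k : ℕ) : InS H (M ^ k) := by
  induction k with
  | zero => rw [pow_zero]; exact InS.one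
  | succ k ih => rw [pow_succ]; exact ih.mul hM

lemma InS.l2 {H : Subgroup GLZ} {a b p q : Mt} (ha : InS H a) (hb : InS H b) (hp : InS H p)
    (e : a * (b * p) = q) : InS H q := e ▸ ha.mul (hb.mul hp)

lemma InS.pal {H : Subgroup GLZ} {a p q : Mt} (ha : InS H a) (hp : InS H p)
    (e : a * p * a = q) : InS H q := e ▸ (ha.mul hp).mul ha

lemma InS.mem {H : Subgroup GLZ} {g : GLZ} (h : InS H (g : Mt)) : g ∈ H := by
  obtain ⟨k, hk, e⟩ := h
  rwa [← Units.ext e]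

lemma InS.conj {H : Subgroup GLZ} {s g : GLZ} {M : Mt} (h : InS H M)
    (e : (s : Mt) * (g : Mt) = M * (s : Mt)) : s * g * s⁻¹ ∈ H := by
  obtain ⟨k, hk, rfl⟩ := h
  have : s * g = k * s := Units.ext e
  rwa [this, mul_inv_cancel_right]

lemma InS.unconj {H : Subgroup GLZ} {d M N : Mt} (hd : InS H d) (hN : InS H N)
    (e : d * M = N * d) : InS H M := by
  obtain ⟨g, hg, rfl⟩ := hd
  have h : InS H (((g⁻¹ : GLZ) : Mt) * (N * (g : Mt))) :=
    InS.mul ⟨g⁻¹, H.inv_mem hg, rfl⟩ (hN.mul ⟨g, hg, rfl⟩)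
  rwa [← e, ← mul_assoc, Units.inv_mul, one_mul] at h

/-! ### A finite index criterion -/

lemma tower {G : Type*} [Group G] (H : Subgroup G) (s : G) (k : ℕ) (hk : 0 < k)
    (hs : s ^ k ∈ H) (hn : ∀ h ∈ H, s * h * s⁻¹ ∈ H) :
    H.relIndex (H ⊔ Subgroup.zpowers s) ≠ 0 := by
  have hpow : ∀ (j : ℕ) (h : G), h ∈ H → s ^ j * h * (s ^ j)⁻¹ ∈ H := by
    intro j
    induction j with
    | zero => intro h hh; simpa using hh
    | succ j ih =>
      intro h hh
      have := hn _ (ih h hh)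
      have e : s ^ (j + 1) * h * (s ^ (j + 1))⁻¹ = s * (s ^ j * h * (s ^ j)⁻¹) * s⁻¹ := by
        rw [pow_succ']; group
      rwa [e]
  have hn' : ∀ h, s * h * s⁻¹ ∈ H → h ∈ H := by
    intro h hh
    have h1 := hpow (k - 1) _ hh
    have e : s ^ (k - 1) * (s * h * s⁻¹) * (s ^ (k - 1))⁻¹ = s ^ k * h * (s ^ k)⁻¹ := by
      obtain ⟨m, rfl⟩ : ∃ m, k = m + 1 := ⟨k - 1, by omega⟩
      simp only [Nat.add_sub_cancel, pow_succ]
      group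
    rw [e] at h1
    have h2 := H.mul_mem (H.mul_mem (H.inv_mem hs) h1) hs
    simpa [mul_assoc] using h2
  have hnorm : Subgroup.zpowers s ≤ Subgroup.normalizer (H : Set G) := by
    rw [Subgroup.zpowers_le, Subgroup.mem_normalizer_iff]
    exact fun h => ⟨hn h, hn' h⟩
  set K := H ⊔ Subgroup.zpowers s with hK
  have hsK : s ∈ K := (le_sup_right : _ ≤ K) (Subgroup.mem_zpowers s)
  have hfin : Finite (K ⧸ H.subgroupOf K) := by
    refine Finite.of_surjective
      (fun i : Fin k => (QuotientGroup.mk (⟨s ^ (i : ℕ), K.pow_mem hsK _⟩ : K) :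
        K ⧸ H.subgroupOf K)) ?_
    intro q
    obtain ⟨⟨y, hy⟩, rfl⟩ := QuotientGroup.mk_surjective q
    have hy' : y ∈ ((Subgroup.zpowers s ⊔ H : Subgroup G) : Set G) := by
      rw [sup_comm]; exact hy
    rw [Subgroup.coe_mul_of_left_le_normalizer_right _ _ hnorm] at hy'
    obtain ⟨a, ⟨z, rfl⟩, h, hh, rfl⟩ := hy'
    have hkz : (0 : ℤ) < k := by exact_mod_cast hk
    have hz0 := Int.emod_nonneg z hkz.ne'
    have hz1 := Int.emod_lt_of_pos z hkz
    refine ⟨⟨(z % k).toNat, by omega⟩, ?_⟩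
    rw [QuotientGroup.eq, Subgroup.mem_subgroupOf]
    have e : s ^ z = s ^ (z % k).toNat * (s ^ k) ^ (z / k) := by
      rw [← zpow_natCast, ← zpow_natCast, ← _root_.zpow_mul, ← _root_.zpow_add, Int.toNat_of_nonneg hz0,
        Int.emod_add_mul_ediv]
    have : (s ^ (z % (k : ℤ)).toNat)⁻¹ * (s ^ z * h) ∈ H := by
      rw [e, mul_assoc, inv_mul_cancel_left]
      exact H.mul_mem (H.zpow_mem hs _) hh
    simpa using this
  have : (H.subgroupOf K).FiniteIndex := Subgroup.finiteIndex_of_finite_quotient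
  exact this.index_ne_zero

/-! ### The reflection group `W` generated by the six reflections -/

/-- The subgroup generated by the reflections `R0, …, R5`. -/
def W : Subgroup GLZ :=
  Subgroup.closure {g : GLZ | (g : Mt) = R0 ∨ (g : Mt) = R1 ∨ (g : Mt) = R2 ∨ (g : Mt) = R3 ∨
    (g : Mt) = R4 ∨ (g : Mt) = R5}

lemma r0 : InS W R0 := ⟨⟨R0, R0, by decide +kernel, by decide +kernel⟩,
  Subgroup.subset_closure (by simp), rfl⟩
lemma r1 : InS W R1 := ⟨⟨R1, R1, by decide +kernel, by decide +kernel⟩,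
  Subgroup.subset_closure (by simp), rfl⟩
lemma r2 : InS W R2 := ⟨⟨R2, R2, by decide +kernel, by decide +kernel⟩,
  Subgroup.subset_closure (by simp), rfl⟩
lemma r3 : InS W R3 := ⟨⟨R3, R3, by decide +kernel, by decide +kernel⟩,
  Subgroup.subset_closure (by simp), rfl⟩
lemma r4 : InS W R4 := ⟨⟨R4, R4, by decide +kernel, by decide +kernel⟩,
  Subgroup.subset_closure (by simp), rfl⟩
lemma r5 : InS W R5 := ⟨⟨R5, R5, by decide +kernel, by decide +kernel⟩,
  Subgroup.subset_closure (by simp), rfl⟩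

lemma S1_mem : InS W S1 :=
  InS.pal r0 (InS.pal r5 r0 rfl) (by decide +kernel)

lemma E1W_mem : InS W E1W := by
  have h0 : InS W (!![1, -1, 1, 1, 0; 0, 1, 0, 0, 0; 0, -1, 1, 0, 0; 0, -1, 0, 1, 0; 0, 0, 0, 0, 1]) := InS.l2 r2 r1 InS.one (by decide +kernel)
  have h1 : InS W (!![8, -36, 15, -20, -168; -1, 6, -2, 3, 24; 1, -4, 2, -4, -24; -4, 21, -9, 12, 96; 1, -5, 2, -3, -23]) := InS.l2 r1 r3 h0 (by decide +kernel)
  have h2 : InS W (!![1, 0, 2, -6, -24; -12, 65, -24, 28, 264; -28, 150, -55, 60, 600; 0, -2, 0, 1, 0; 1, -5, 2, -3, -23]) := InS.l2 r5 r2 h1 (by decide +kernel)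
  have h3 : InS W (!![-65, 408, -123, 124, 1416; 10, -63, 19, -18, -216; -50, 296, -95, 100, 1080; 11, -69, 21, -21, -240; -10, 62, -19, 19, 217]) := InS.l2 r3 r0 h2 (by decide +kernel)
  have h4 : InS W (!![-3, 26, -6, 5, 72; 2, -18, 3, -4, -48; 6, -57, 9, -10, -144; 1, -8, 2, -2, -24; 0, 1, 0, 0, 1]) := InS.l2 r5 r4 h3 (by decide +kernel)
  have h5 : InS W (!![2, -21, 2, -3, -48; 2, -18, 3, -4, -48; 4, -39, 6, -6, -96; -1, 10, -1, 2, 24; 0, 1, 0, 0, 1]) := InS.l2 r2 r1 h4 (by decide +kernel)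
  have h6 : InS W (!![1, -12, 0, -1, -24; 0, 1, 0, -1, 0; 1, -11, 1, -1, -24; 0, 0, 0, 1, 0; 0, 1, 0, 0, 1]) := InS.l2 r2 r0 h5 (by decide +kernel)
  have h7 : InS W (E1W) := InS.l2 r0 r5 h6 (by decide +kernel)
  exact h7
lemma E2W_mem : InS W E2W := by
  have h0 : InS W (!![24, -19, 6, 4, -144; -5, 3, -1, -3, 24; 18, -17, 6, 1, -120; -4, 3, -1, 0, 24; 4, -3, 1, 1, -23]) := InS.l2 r4 r0 InS.one (by decide +kernel)
  have h1 : InS W (!![4, 0, 0, 9, 0; -1, -2, 1, -14, -24; 8, -9, 4, -9, -72; -1, 0, 0, -2, 0; 1, 0, 0, 3, 1]) := InS.l2 r0 r3 h0 (by decide +kernel)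
  have h2 : InS W (!![0, 11, -7, 84, 168; 2, -12, 8, -93, -192; 7, -8, 4, -13, -72; 0, -3, 2, -24, -48; 0, 3, -2, 25, 49]) := InS.l2 r0 r4 h1 (by decide +kernel)
  have h3 : InS W (!![-9, 0, 0, -10, 0; 1, 1, -1, 13, 24; -3, 10, -9, 130, 240; 1, 0, 0, 1, 0; -1, 0, 0, 0, 1]) := InS.l2 r3 r5 h2 (by decide +kernel)
  have h4 : InS W (!![-8, -11, 10, -154, -264; 1, 1, -1, 13, 24; -2, 11, -10, 143, 264; 2, 1, -1, 14, 24; -1, 0, 0, 0, 1]) := InS.l2 r1 r2 h3 (by decide +kernel)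
  have h5 : InS W (!![1, 0, -1, 12, 24; 0, 1, -1, 12, 24; 0, 0, 1, -12, -24; 1, 1, -1, 13, 24; 0, 0, 0, 1, 1]) := InS.l2 r3 r4 h4 (by decide +kernel)
  have h6 : InS W (!![0, -1, 3, -36, -72; -1, 0, 3, -36, -72; -3, -3, 9, -109, -216; 0, 0, -1, 12, 24; 0, 0, 0, 1, 1]) := InS.l2 r0 r1 h5 (by decide +kernel)
  have h7 : InS W (E2W) := InS.l2 r1 r5 h6 (by decide +kernel)
  exact h7
lemma X12_mem : InS W X12 := by
  have h0 : InS W (!![2, -1, 1, -10, -24; 0, 0, 0, 1, 0; -1, 12, 0, -1, 24; 0, -1, 0, 2, 0; 0, 1, 0, -1, 1]) := InS.l2 r4 r3 InS.one (by decide +kernel)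
  have h1 : InS W (!![1, 10, 1, -10, 0; 0, 0, 0, 1, 0; -1, 12, 0, -2, 24; 0, -1, 0, 1, 0; 0, 1, 0, -1, 1]) := InS.l2 r2 r1 h0 (by decide +kernel)
  have h2 : InS W (!![1, 9, 1, -9, 0; 0, -1, 0, 2, 0; -2, 3, -1, 6, 24; 0, -1, 0, 1, 0; 0, 1, 0, -1, 1]) := InS.l2 r0 r5 h1 (by decide +kernel)
  have h3 : InS W (!![0, 8, 1, 0, 0; 0, -1, 0, 1, 0; -1, 4, -1, 8, 24; 0, -1, 0, 0, 0; 0, 1, 0, 0, 1]) := InS.l2 r4 r3 h2 (by decide +kernel)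
  have h4 : InS W (!![-1, 12, 0, 7, 24; 0, -1, 0, 1, 0; -1, 5, -1, 7, 24; 0, 0, 0, -1, 0; 0, 1, 0, 0, 1]) := InS.l2 r2 r1 h3 (by decide +kernel)
  have h5 : InS W (!![-1, 12, 0, 6, 24; 0, -1, 0, 0, 0; 0, -6, -1, 0, 0; 0, 0, 0, -1, 0; 0, 1, 0, 0, 1]) := InS.l2 r0 r5 h4 (by decide +kernel)
  have h6 : InS W (!![-2, -5, -1, 22, 24; 0, 0, 0, -1, 0; 1, 0, 0, -5, 0; 0, 1, 0, -2, 0; 0, 0, 0, 1, 1]) := InS.l2 r4 r3 h5 (by decide +kernel)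
  have h7 : InS W (!![-1, -4, -1, 16, 24; 0, 0, 0, -1, 0; 1, 0, 0, -4, 0; 0, 1, 0, -1, 0; 0, 0, 0, 1, 1]) := InS.l2 r2 r1 h6 (by decide +kernel)
  have h8 : InS W (!![-1, -3, -1, 15, 24; 0, 1, 0, -2, 0; 2, 3, 1, -18, -24; 0, 1, 0, -1, 0; 0, 0, 0, 1, 1]) := InS.l2 r0 r5 h7 (by decide +kernel)
  have h9 : InS W (!![0, -14, -1, 0, 0; 0, 1, 0, -1, 0; 1, 14, 1, -14, 0; 0, 1, 0, 0, 0; 0, 0, 0, 0, 1]) := InS.l2 r4 r3 h8 (by decide +kernel)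
  have h10 : InS W (!![1, 0, 0, -13, 0; 0, 1, 0, -1, 0; 1, 13, 1, -13, 0; 0, 0, 0, 1, 0; 0, 0, 0, 0, 1]) := InS.l2 r2 r1 h9 (by decide +kernel)
  have h11 : InS W (X12) := InS.l2 r0 r5 h10 (by decide +kernel)
  exact h11
lemma conj_X_0 : InS W (!![0, -1, 0, -3, 0; -1, 0, 0, -3, 0; -3, -3, 1, -9, 0; 0, 0, 0, 1, 0; 0, 0, 0, 0, 1]) := by
  exact r5
lemma conj_X_1 : InS W (!![1, -1, 1, 1, 0; 0, 1, 0, 0, 0; 0, 1, 0, -1, 0; 0, 1, -1, 0, 0; 0, 0, 0, 0, 1]) := by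
  have h0 : InS W (!![1, -1, 1, 1, 0; 0, 1, 0, 0, 0; 0, 1, 0, -1, 0; 0, 1, -1, 0, 0; 0, 0, 0, 0, 1]) := InS.pal r1 r2 (by decide +kernel)
  exact h0
lemma conj_X_2 : InS W (!![1, 0, 0, 0, 0; 0, 1, 0, 0, 0; 0, 0, 0, -1, 0; 0, 0, -1, 0, 0; 0, 0, 0, 0, 1]) := by
  exact r1
lemma conj_X_3 : InS W (!![9, -64, 8, -24, -192; -1, 9, -1, 3, 24; 3, -24, 4, -9, -72; -1, 8, -1, 4, 24; 1, -8, 1, -3, -23]) := by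
  have h0 : InS W (!![9, -64, 8, -24, -192; -1, 9, -1, 3, 24; 3, -24, 4, -9, -72; -1, 8, -1, 4, 24; 1, -8, 1, -3, -23]) := InS.pal r3 r4 (by decide +kernel)
  exact h0
lemma conj_X_4 : InS W (!![8, -49, 7, -28, -168; -1, 8, -1, 4, 24; 4, -28, 5, -16, -96; -1, 7, -1, 5, 24; 1, -7, 1, -4, -23]) := by
  exact r3
lemma conj_X_5 : InS W (!![0, -1, 0, -4, 0; -1, 0, 0, -4, 0; -4, -4, 1, -16, 0; 0, 0, 0, 1, 0; 0, 0, 0, 0, 1]) := by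
  have h0 : InS W (!![0, -1, 0, -4, 0; -1, 0, 0, -4, 0; -4, -4, 1, -16, 0; 0, 0, 0, 1, 0; 0, 0, 0, 0, 1]) := InS.pal r5 r0 (by decide +kernel)
  exact h0
lemma conj_N2_0 : InS W (!![0, -1, -2, 0, 0; -1, 0, -2, 0, 0; 0, 0, 1, 0, 0; -2, -2, -4, 1, 0; 0, 0, 0, 0, 1]) := by
  have h0 : InS W (!![0, -1, 2, 0, 0; -1, 0, 2, 0, 0; 0, 0, 1, 0, 0; 2, 2, -4, 1, 0; 0, 0, 0, 0, 1]) := InS.pal r1 r0 (by decide +kernel)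
  have h1 : InS W (!![-24, -25, 10, -60, 0; -25, -24, 10, -60, 0; -60, -60, 25, -144, 0; 10, 10, -4, 25, 0; 0, 0, 0, 0, 1]) := InS.pal r5 h0 (by decide +kernel)
  have h2 : InS W (!![0, -1, -2, 0, 0; -1, 0, -2, 0, 0; 0, 0, 1, 0, 0; -2, -2, -4, 1, 0; 0, 0, 0, 0, 1]) := InS.pal r0 h1 (by decide +kernel)
  exact h2
lemma conj_N2_1 : InS W (!![1, 0, 0, 0, 0; 0, 1, 0, 0, 0; 0, 0, 0, -1, 0; 0, 0, -1, 0, 0; 0, 0, 0, 0, 1]) := by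
  exact r1
lemma conj_N2_2 : InS W (!![1, -1, -1, -1, 0; 0, 1, 0, 0, 0; 0, -1, 0, -1, 0; 0, -1, -1, 0, 0; 0, 0, 0, 0, 1]) := by
  exact r2
lemma conj_N2_3 : InS W (!![8, -49, -28, 7, -168; -1, 8, 4, -1, 24; -1, 7, 5, -1, 24; 4, -28, -16, 5, -96; 1, -7, -4, 1, -23]) := by
  have h0 : InS W (!![16, -9, 3, 12, -72; -25, 16, -5, -20, 120; -20, 12, -3, -16, 96; -5, 3, -1, -3, 24; 5, -3, 1, 4, -23]) := InS.pal r0 r3 (by decide +kernel)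
  have h1 : InS W (!![16, -9, -12, -3, -72; -25, 16, 20, 5, 120; 5, -3, -3, -1, -24; 20, -12, -16, -3, -96; 5, -3, -4, -1, -23]) := InS.pal r1 h0 (by decide +kernel)
  have h2 : InS W (!![-104, -49, 28, -203, 168; -225, -104, 60, -435, 360; -435, -203, 117, -841, 696; 60, 28, -16, 117, -96; 15, 7, -4, 29, -23]) := InS.pal r5 h1 (by decide +kernel)
  have h3 : InS W (!![8, -49, -28, 7, -168; -1, 8, 4, -1, 24; -1, 7, 5, -1, 24; 4, -28, -16, 5, -96; 1, -7, -4, 1, -23]) := InS.pal r0 h2 (by decide +kernel)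
  exact h3
lemma conj_N2_4 : InS W (!![7, -36, -30, 6, -144; -1, 7, 5, -1, 24; -1, 6, 6, -1, 24; 5, -30, -25, 6, -120; 1, -6, -5, 1, -23]) := by
  have h0 : InS W (!![13, -9, 3, 3, -72; -16, 13, -4, -4, 96; -4, 3, 0, -1, 24; -4, 3, -1, 0, 24; 4, -3, 1, 1, -23]) := InS.pal r0 r4 (by decide +kernel)
  have h1 : InS W (!![13, -9, -3, -3, -72; -16, 13, 4, 4, 96; 4, -3, 0, -1, -24; 4, -3, -1, 0, -24; 4, -3, -1, -1, -23]) := InS.pal r1 h0 (by decide +kernel)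
  have h2 : InS W (!![7, -1, -1, 5, -24; -36, 7, 6, -30, 144; -30, 5, 6, -25, 120; 6, -1, -1, 6, -24; 6, -1, -1, 5, -23]) := InS.pal r5 h1 (by decide +kernel)
  have h3 : InS W (!![7, -1, -5, 1, -24; -36, 7, 30, -6, 144; -6, 1, 6, -1, 24; 30, -5, -25, 6, -120; 6, -1, -5, 1, -23]) := InS.pal r1 h2 (by decide +kernel)
  have h4 : InS W (!![-143, -81, 45, -279, 216; -256, -143, 80, -496, 384; -496, -279, 156, -961, 744; 80, 45, -25, 156, -120; 16, 9, -5, 31, -23]) := InS.pal r5 h3 (by decide +kernel)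
  have h5 : InS W (!![7, -36, -30, 6, -144; -1, 7, 5, -1, 24; -1, 6, 6, -1, 24; 5, -30, -25, 6, -120; 1, -6, -5, 1, -23]) := InS.pal r0 h4 (by decide +kernel)
  exact h5
lemma conj_N2_5 : InS W (!![0, -1, -3, 0, 0; -1, 0, -3, 0, 0; 0, 0, 1, 0, 0; -3, -3, -9, 1, 0; 0, 0, 0, 0, 1]) := by
  have h0 : InS W (!![-3, -4, 2, -6, 0; -4, -3, 2, -6, 0; -6, -6, 4, -9, 0; 2, 2, -1, 4, 0; 0, 0, 0, 0, 1]) := InS.pal r0 r1 (by decide +kernel)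
  have h1 : InS W (!![-3, -4, 6, -2, 0; -4, -3, 6, -2, 0; -2, -2, 4, -1, 0; 6, 6, -9, 4, 0; 0, 0, 0, 0, 1]) := InS.pal r1 h0 (by decide +kernel)
  have h2 : InS W (!![-48, -49, 21, -112, 0; -49, -48, 21, -112, 0; -112, -112, 49, -256, 0; 21, 21, -9, 49, 0; 0, 0, 0, 0, 1]) := InS.pal r5 h1 (by decide +kernel)
  have h3 : InS W (!![0, -1, -3, 0, 0; -1, 0, -3, 0, 0; 0, 0, 1, 0, 0; -3, -3, -9, 1, 0; 0, 0, 0, 0, 1]) := InS.pal r0 h2 (by decide +kernel)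
  exact h3
lemma conj_RHO_0 : InS W (!![0, -1, 6, -8, -48; -1, 0, 6, -8, -48; -8, -8, 49, -64, -384; 6, 6, -36, 49, 288; -2, -2, 12, -16, -95]) := by
  have h0 : InS W (!![13, -9, 3, 3, -72; -16, 13, -4, -4, 96; -4, 3, 0, -1, 24; -4, 3, -1, 0, 24; 4, -3, 1, 1, -23]) := InS.pal r0 r4 (by decide +kernel)
  have h1 : InS W (!![496, -2025, 360, -1530, -8640; -121, 496, -88, 374, 2112; 374, -1530, 273, -1156, -6528; -88, 360, -64, 273, 1536; 88, -360, 64, -272, -1535]) := InS.pal r4 h0 (by decide +kernel)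
  have h2 : InS W (!![120, -289, 68, -306, -1632; -49, 120, -28, 126, 672; 126, -306, 73, -324, -1728; -28, 68, -16, 73, 384; 28, -68, 16, -72, -383]) := InS.pal r3 h1 (by decide +kernel)
  have h3 : InS W (!![120, -289, 306, -68, -1632; -49, 120, -126, 28, 672; 28, -68, 73, -16, -384; -126, 306, -324, 73, 1728; 28, -68, 72, -16, -383]) := InS.pal r1 h2 (by decide +kernel)
  have h4 : InS W (!![267, -1444, -114, -950, -3648; -49, 267, 21, 175, 672; 175, -950, -74, -625, -2400; 21, -114, -9, -74, -288; 28, -152, -12, -100, -383]) := InS.pal r2 h3 (by decide +kernel)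
  have h5 : InS W (!![3, -4, -18, 10, 96; -1, 3, 9, -5, -48; -5, 10, 46, -25, -240; 9, -18, -81, 46, 432; -2, 4, 18, -10, -95]) := InS.pal r4 h4 (by decide +kernel)
  have h6 : InS W (!![0, -1, 6, -8, -48; -1, 0, 6, -8, -48; -8, -8, 49, -64, -384; 6, 6, -36, 49, 288; -2, -2, 12, -16, -95]) := InS.pal r2 h5 (by decide +kernel)
  exact h6
lemma conj_RHO_1 : InS W (!![1, 0, 0, 0, 0; 0, 1, 0, 0, 0; 0, 0, 0, -1, 0; 0, 0, -1, 0, 0; 0, 0, 0, 0, 1]) := by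
  exact r1
lemma conj_RHO_2 : InS W (!![1, -1, -1, -1, 0; 0, 1, 0, 0, 0; 0, -1, 0, -1, 0; 0, -1, -1, 0, 0; 0, 0, 0, 0, 1]) := by
  exact r2
lemma conj_RHO_3 : InS W (!![8, -49, -56, 35, 336; -1, 8, 8, -5, -48; -5, 35, 41, -25, -240; 8, -56, -64, 41, 384; -2, 14, 16, -10, -95]) := by
  have h0 : InS W (!![-3, -4, 2, -6, 0; -4, -3, 2, -6, 0; -6, -6, 4, -9, 0; 2, 2, -1, 4, 0; 0, 0, 0, 0, 1]) := InS.pal r0 r1 (by decide +kernel)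
  have h1 : InS W (!![5, -4, -10, -2, 0; -4, 5, 10, 2, 0; 2, -2, -4, -1, 0; 10, -10, -25, -4, 0; 0, 0, 0, 0, 1]) := InS.pal r2 h0 (by decide +kernel)
  have h2 : InS W (!![465, -3364, 870, -2842, -13920; -64, 465, -120, 392, 1920; 392, -2842, 736, -2401, -11760; -120, 870, -225, 736, 3600; 80, -580, 150, -490, -2399]) := InS.pal r4 h1 (by decide +kernel)
  have h3 : InS W (!![690, -2809, 795, -1802, -12720; -169, 690, -195, 442, 3120; 442, -1802, 511, -1156, -8160; -195, 795, -225, 511, 3600; 130, -530, 150, -340, -2399]) := InS.pal r5 h2 (by decide +kernel)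
  have h4 : InS W (!![690, -2809, 1802, -795, -12720; -169, 690, -442, 195, 3120; 195, -795, 511, -225, -3600; -442, 1802, -1156, 511, 8160; 130, -530, 340, -150, -2399]) := InS.pal r1 h3 (by decide +kernel)
  have h5 : InS W (!![-1214, -6561, 2754, -5751, -19440; -225, -1214, 510, -1065, -3600; -1065, -5751, 2415, -5041, -17040; 510, 2754, -1156, 2415, 8160; -150, -810, 340, -710, -2399]) := InS.pal r0 h4 (by decide +kernel)
  have h6 : InS W (!![-758, -1089, 858, -1023, -1584; -529, -758, 598, -713, -1104; -713, -1023, 807, -961, -1488; 598, 858, -676, 807, 1248; -46, -66, 52, -62, -95]) := InS.pal r4 h5 (by decide +kernel)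
  have h7 : InS W (!![-758, -1089, 1023, -858, -1584; -529, -758, 713, -598, -1104; -598, -858, 807, -676, -1248; 713, 1023, -961, 807, 1488; -46, -66, 62, -52, -95]) := InS.pal r1 h6 (by decide +kernel)
  have h8 : InS W (!![-344, -225, 735, -120, -720; -529, -344, 1127, -184, -1104; -184, -120, 393, -64, -384; 1127, 735, -2401, 393, 2352; -46, -30, 98, -16, -95]) := InS.pal r2 h7 (by decide +kernel)
  have h9 : InS W (!![-344, -225, 120, -735, -720; -529, -344, 184, -1127, -1104; -1127, -735, 393, -2401, -2352; 184, 120, -64, 393, 384; -46, -30, 16, -98, -95]) := InS.pal r1 h8 (by decide +kernel)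
  have h10 : InS W (!![8, -49, -56, 35, 336; -1, 8, 8, -5, -48; -5, 35, 41, -25, -240; 8, -56, -64, 41, 384; -2, 14, 16, -10, -95]) := InS.pal r0 h9 (by decide +kernel)
  exact h10
lemma conj_RHO_4 : InS W (!![7, -36, -30, 6, 144; -1, 7, 5, -1, -24; -1, 6, 6, -1, -24; 5, -30, -25, 6, 120; -1, 6, 5, -1, -23]) := by
  have h0 : InS W (!![136, -729, 108, -378, -2592; -25, 136, -20, 70, 480; 70, -378, 57, -196, -1344; -20, 108, -16, 57, 384; 20, -108, 16, -56, -383]) := InS.pal r3 r0 (by decide +kernel)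
  have h1 : InS W (!![1, -9, 3, -33, -72; 0, 1, 0, 0, 0; 0, -33, 12, -121, -264; 0, 3, -1, 12, 24; 0, -3, 1, -11, -23]) := InS.pal r4 h0 (by decide +kernel)
  have h2 : InS W (!![1, -49, -77, 7, 168; 0, 1, 0, 0, 0; 0, 7, 12, -1, -24; 0, -77, -121, 12, 264; 0, 7, 11, -1, -23]) := InS.pal r2 h1 (by decide +kernel)
  have h3 : InS W (!![1, -49, -7, 77, 168; 0, 1, 0, 0, 0; 0, 77, 12, -121, -264; 0, -7, -1, 12, 24; 0, 7, 1, -11, -23]) := InS.pal r1 h2 (by decide +kernel)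
  have h4 : InS W (!![-17, -4, 2, -58, -48; -81, -17, 9, -261, -216; -261, -58, 30, -841, -696; 9, 2, -1, 30, 24; -9, -2, 1, -29, -23]) := InS.pal r0 h3 (by decide +kernel)
  have h5 : InS W (!![7, -36, -6, 30, 144; -1, 7, 1, -5, -24; -5, 30, 6, -25, -120; 1, -6, -1, 6, 24; -1, 6, 1, -5, -23]) := InS.pal r5 h4 (by decide +kernel)
  have h6 : InS W (!![7, -36, -30, 6, 144; -1, 7, 5, -1, -24; -1, 6, 6, -1, -24; 5, -30, -25, 6, 120; -1, 6, 5, -1, -23]) := InS.pal r1 h5 (by decide +kernel)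
  exact h6
lemma conj_RHO_5 : InS W (!![0, -1, 9, -12, -72; -1, 0, 9, -12, -72; -12, -12, 109, -144, -864; 9, 9, -81, 109, 648; -3, -3, 27, -36, -215]) := by
  have h0 : InS W (!![16, -9, 3, 12, -72; -25, 16, -5, -20, 120; -20, 12, -3, -16, 96; -5, 3, -1, -3, 24; 5, -3, 1, 4, -23]) := InS.pal r0 r3 (by decide +kernel)
  have h1 : InS W (!![946, -3969, 693, -2898, -16632; -225, 946, -165, 690, 3960; 690, -2898, 507, -2116, -12144; -165, 693, -121, 507, 2904; 165, -693, 121, -506, -2903]) := InS.pal r4 h0 (by decide +kernel)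
  have h2 : InS W (!![190, -441, 105, -462, -2520; -81, 190, -45, 198, 1080; 198, -462, 111, -484, -2640; -45, 105, -25, 111, 600; 45, -105, 25, -110, -599]) := InS.pal r3 h1 (by decide +kernel)
  have h3 : InS W (!![190, -441, 462, -105, -2520; -81, 190, -198, 45, 1080; 45, -105, 111, -25, -600; -198, 462, -484, 111, 2640; 45, -105, 110, -25, -599]) := InS.pal r1 h2 (by decide +kernel)
  have h4 : InS W (!![424, -2209, -188, -1457, -5640; -81, 424, 36, 279, 1080; 279, -1457, -123, -961, -3720; 36, -188, -16, -123, -480; 45, -235, -20, -155, -599]) := InS.pal r2 h3 (by decide +kernel)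
  have h5 : InS W (!![0, -1, 12, -9, -72; -1, 0, 12, -9, -72; -9, -9, 109, -81, -648; 12, 12, -144, 109, 864; -3, -3, 36, -27, -215]) := InS.pal r4 h4 (by decide +kernel)
  have h6 : InS W (!![0, -1, 9, -12, -72; -1, 0, 9, -12, -72; -12, -12, 109, -144, -864; 9, 9, -81, 109, 648; -3, -3, 27, -36, -215]) := InS.pal r1 h5 (by decide +kernel)
  exact h6

lemma W_conj {H : Subgroup GLZ} {s : GLZ} {c0 c1 c2 c3 c4 c5 : Mt}
    (h0 : InS H c0) (e0 : (s : Mt) * R0 = c0 * (s : Mt))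
    (h1 : InS H c1) (e1 : (s : Mt) * R1 = c1 * (s : Mt))
    (h2 : InS H c2) (e2 : (s : Mt) * R2 = c2 * (s : Mt))
    (h3 : InS H c3) (e3 : (s : Mt) * R3 = c3 * (s : Mt))
    (h4 : InS H c4) (e4 : (s : Mt) * R4 = c4 * (s : Mt))
    (h5 : InS H c5) (e5 : (s : Mt) * R5 = c5 * (s : Mt)) :
    W ≤ H.comap (MulAut.conj s).toMonoidHom := by
  rw [W, Subgroup.closure_le]
  rintro g (h | h | h | h | h | h)
  · exact h0.conj (h ▸ e0)
  · exact h1.conj (h ▸ e1)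
  · exact h2.conj (h ▸ e2)
  · exact h3.conj (h ▸ e3)
  · exact h4.conj (h ▸ e4)
  · exact h5.conj (h ▸ e5)

/-- The Eichler transvection `X`. -/
def gX : GLZ := ⟨X, XI, by decide +kernel, by decide +kernel⟩
/-- Minus the identity. -/
def gNeg : GLZ := ⟨-1, -1, by simp, by simp⟩
/-- Reflection in a vector of norm `-2`. -/
def gN2 : GLZ := ⟨N2, N2, by decide +kernel, by decide +kernel⟩
/-- Reflection in a vector of norm `6`. -/
def gRho : GLZ := ⟨RHO, RHO, by decide +kernel, by decide +kernel⟩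

/-- First layer of the tower. -/
def H1 : Subgroup GLZ := W ⊔ Subgroup.zpowers gX
/-- Second layer of the tower. -/
def H2 : Subgroup GLZ := H1 ⊔ Subgroup.zpowers gNeg
/-- Third layer of the tower. -/
def H3 : Subgroup GLZ := H2 ⊔ Subgroup.zpowers gN2
/-- Top layer of the tower. -/
def H4 : Subgroup GLZ := H3 ⊔ Subgroup.zpowers gRho

lemma W_le_H1 : W ≤ H1 := le_sup_left
lemma H1_le_H2 : H1 ≤ H2 := le_sup_left
lemma H2_le_H3 : H2 ≤ H3 := le_sup_left
lemma H3_le_H4 : H3 ≤ H4 := le_sup_left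
lemma H1_le_H3 : H1 ≤ H3 := H1_le_H2.trans H2_le_H3
lemma H1_le_H4 : H1 ≤ H4 := H1_le_H3.trans H3_le_H4
lemma W_le_H4 : W ≤ H4 := W_le_H1.trans H1_le_H4

lemma X_mem : InS H1 X :=
  ⟨gX, (le_sup_right : _ ≤ H1) (Subgroup.mem_zpowers _), rfl⟩
lemma XI_mem : InS H1 XI := X_mem.inv (by decide +kernel)
lemma E1F2_mem : InS H1 E1F2 := InS.pal (r1.mono W_le_H1) XI_mem (by decide +kernel)
lemma E1F2I_mem : InS H1 E1F2I := InS.pal (r1.mono W_le_H1) X_mem (by decide +kernel)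
lemma F1E2_mem : InS H1 F1E2 := InS.pal (S1_mem.mono W_le_H1) XI_mem (by decide +kernel)
lemma F1E2I_mem : InS H1 F1E2I := InS.pal (S1_mem.mono W_le_H1) X_mem (by decide +kernel)
lemma F1F2_mem : InS H1 F1F2 := InS.pal (r1.mono W_le_H1) F1E2I_mem (by decide +kernel)
lemma F1F2I_mem : InS H1 F1F2I := InS.pal (r1.mono W_le_H1) F1E2_mem (by decide +kernel)
lemma E1WI_mem : InS W E1WI := E1W_mem.inv (by decide +kernel)
lemma F1W_mem : InS W F1W := InS.pal S1_mem E1WI_mem (by decide +kernel)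
lemma F1WI_mem : InS W F1WI := InS.pal S1_mem E1W_mem (by decide +kernel)
lemma N2_mem : InS H3 N2 :=
  ⟨gN2, (le_sup_right : _ ≤ H3) (Subgroup.mem_zpowers _), rfl⟩
lemma RHO_mem : InS H4 RHO :=
  ⟨gRho, (le_sup_right : _ ≤ H4) (Subgroup.mem_zpowers _), rfl⟩
lemma Neg_mem : InS H2 (-1) :=
  ⟨gNeg, (le_sup_right : _ ≤ H2) (Subgroup.mem_zpowers _), rfl⟩

/-- `N1` is conjugate to `N2` by `F1F2 * F1E2I * X`. -/
lemma N1_mem : InS H3 N1 := by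
  have hd : InS H3 (F1F2 * F1E2I * X) :=
    ((F1F2_mem.mul F1E2I_mem).mul X_mem).mono H1_le_H3
  have hd' : InS H3 (XI * F1E2 * F1F2I) :=
    ((XI_mem.mul F1E2_mem).mul F1F2I_mem).mono H1_le_H3
  have h := (hd.mul N2_mem).mul hd'
  have e : F1F2 * F1E2I * X * N2 * (XI * F1E2 * F1F2I) = N1 := by decide +kernel
  rwa [e] at h

lemma RW_mem : InS H3 RW := by
  have h := (((((Neg_mem.mono H2_le_H3).mul (S1_mem.mono (W_le_H1.trans H1_le_H3))).mul
    N1_mem).mul (r1.mono (W_le_H1.trans H1_le_H3)))).mul N2_mem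
  have e : (-1 : Mt) * S1 * N1 * R1 * N2 = RW := by decide +kernel
  rwa [e] at h

lemma idx1 : W.relIndex H1 ≠ 0 := by
  refine tower W gX 12 (by norm_num) (InS.mem ?_) ?_
  · have e : ((gX ^ 12 : GLZ) : Mt) = X12 := by
      have e3 : X * (X * X) = !![1, 0, 0, -3, 0; 0, 1, 0, 0, 0; 0, 3, 1, 0, 0; 0, 0, 0, 1, 0;
        0, 0, 0, 0, 1] := by decide +kernel
      have : ((gX ^ 12 : GLZ) : Mt) = (X * (X * X)) * (X * (X * X)) * (X * (X * X)) *
          (X * (X * X)) := by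
        rw [Units.val_pow_eq_pow_val]
        change X ^ 12 = _
        noncomm_ring
      rw [this, e3]
      decide +kernel
    rw [e]; exact X12_mem
  · exact W_conj conj_X_0 (by decide +kernel) conj_X_1 (by decide +kernel)
      conj_X_2 (by decide +kernel) conj_X_3 (by decide +kernel)
      conj_X_4 (by decide +kernel) conj_X_5 (by decide +kernel)

lemma idx2 : H1.relIndex H2 ≠ 0 := by
  refine tower H1 gNeg 2 (by norm_num) ?_ ?_
  · have : gNeg ^ 2 = 1 := Units.ext (by simp [gNeg])
    rw [this]; exact H1.one_mem
  · intro h hh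
    refine InS.conj ⟨h, hh, rfl⟩ ?_
    simp [gNeg]

lemma conj_neg {H : Subgroup GLZ} (hneg : InS H (-1)) (s : GLZ) :
    Subgroup.zpowers gNeg ≤ H.comap (MulAut.conj s).toMonoidHom := by
  rw [Subgroup.zpowers_le]
  exact hneg.conj (by simp [gNeg])

lemma idx3 : H2.relIndex H3 ≠ 0 := by
  refine tower H2 gN2 2 (by norm_num) ?_ ?_
  · have : gN2 ^ 2 = 1 := by
      rw [pow_two]; exact Units.ext (show N2 * N2 = 1 by decide +kernel)
    rw [this]; exact H2.one_mem
  · have hW : W ≤ H2 := W_le_H1.trans H1_le_H2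
    have key : H2 ≤ H2.comap (MulAut.conj gN2).toMonoidHom := by
      refine sup_le (sup_le ?_ ?_) (conj_neg Neg_mem _)
      · exact W_conj (conj_N2_0.mono hW) (by decide +kernel) (conj_N2_1.mono hW) (by decide +kernel)
          (conj_N2_2.mono hW) (by decide +kernel) (conj_N2_3.mono hW) (by decide +kernel)
          (conj_N2_4.mono hW) (by decide +kernel) (conj_N2_5.mono hW) (by decide +kernel)
      · rw [Subgroup.zpowers_le]
        exact (E1F2_mem.mono H1_le_H2).conj (show N2 * X = E1F2 * N2 by decide +kernel)
    exact fun h hh => key hh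

/-- The reflection `RHO * N2 * RHO` as a conjugate of `N1`. -/
lemma RN_mem : InS H3 (RHO * N2 * RHO) := by
  have hX7 : InS H1 !![1, 0, 0, -7, 0; 0, 1, 0, 0, 0; 0, 7, 1, 0, 0; 0, 0, 0, 1, 0;
      0, 0, 0, 0, 1] := by
    have h := (X_mem.pow 7)
    have e : X ^ 7 = X * X * X * X * X * X * X := by noncomm_ring
    rw [e] at h
    have e' : X * X * X * X * X * X * X = !![1, 0, 0, -7, 0; 0, 1, 0, 0, 0; 0, 7, 1, 0, 0;
      0, 0, 0, 1, 0; 0, 0, 0, 0, 1] := by decide +kernel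
    rwa [e'] at h
  have hY7 : InS H1 !![1, 0, 0, 0, 0; 0, 1, 0, 7, 0; -7, 0, 1, 0, 0; 0, 0, 0, 1, 0;
      0, 0, 0, 0, 1] := InS.pal (S1_mem.mono W_le_H1) hX7 (by decide +kernel)
  have hY7' : InS H1 !![1, 0, 0, 0, 0; 0, 1, 0, -7, 0; 7, 0, 1, 0, 0; 0, 0, 0, 1, 0;
      0, 0, 0, 0, 1] := hY7.inv (by decide +kernel)
  have hZ7 : InS H1 !![1, 0, 0, 0, 0; 0, 1, -7, 0, 0; 0, 0, 1, 0, 0; 7, 0, 0, 1, 0;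
      0, 0, 0, 0, 1] := InS.pal (r1.mono W_le_H1) hY7 (by decide +kernel)
  have hd := (((((F1WI_mem.mul F1WI_mem).mono W_le_H1).mul hZ7).mul hY7).mul
    (E1W_mem.mono W_le_H1)).mul hX7
  exact InS.unconj (hd.mono H1_le_H3) N1_mem (by decide +kernel)

lemma idx4 : H3.relIndex H4 ≠ 0 := by
  refine tower H3 gRho 2 (by norm_num) ?_ ?_
  · have : gRho ^ 2 = 1 := by
      rw [pow_two]; exact Units.ext (show RHO * RHO = 1 by decide +kernel)
    rw [this]; exact H3.one_mem
  · have hW : W ≤ H3 := W_le_H1.trans H1_le_H3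
    have key : H3 ≤ H3.comap (MulAut.conj gRho).toMonoidHom := by
      refine sup_le (sup_le (sup_le ?_ ?_) (conj_neg (Neg_mem.mono H2_le_H3) _)) ?_
      · exact W_conj (conj_RHO_0.mono hW) (by decide +kernel)
          (conj_RHO_1.mono hW) (by decide +kernel)
          (conj_RHO_2.mono hW) (by decide +kernel) (conj_RHO_3.mono hW) (by decide +kernel)
          (conj_RHO_4.mono hW) (by decide +kernel) (conj_RHO_5.mono hW) (by decide +kernel)
      · rw [Subgroup.zpowers_le]
        have h := ((((((((X_mem.mul X_mem).mul X_mem).mul X_mem).mul E1F2I_mem).mul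
          E1F2I_mem).mul E1F2I_mem).mul (E1W_mem.mono W_le_H1))).mono H1_le_H3
        exact h.conj (show RHO * X = X * X * X * X * E1F2I * E1F2I * E1F2I * E1W * RHO by
          decide +kernel)
      · rw [Subgroup.zpowers_le]
        exact RN_mem.conj (show RHO * N2 = RHO * N2 * RHO * RHO by decide +kernel)
    exact fun h hh => key hh

lemma idx : W.relIndex H4 ≠ 0 :=
  Subgroup.relIndex_ne_zero_trans (Subgroup.relIndex_ne_zero_trans
    (Subgroup.relIndex_ne_zero_trans idx1 idx2) idx3) idx4

/-! ### The orthogonal group of `mJ` is contained in `H4` -/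

lemma W_le_O : W ≤ orthogonalSubgroup mJ := by
  rw [W, Subgroup.closure_le]
  rintro g (h | h | h | h | h | h) <;>
  · change (g : Mt)ᵀ * mJ * (g : Mt) = mJ
    rw [h]
    decide +kernel

lemma H4_le_O : H4 ≤ orthogonalSubgroup mJ := by
  refine sup_le (sup_le (sup_le (sup_le W_le_O ?_) ?_) ?_) ?_
  · rw [Subgroup.zpowers_le]
    exact (show Xᵀ * mJ * X = mJ by decide +kernel)
  · rw [Subgroup.zpowers_le]
    exact (show (-1 : Mt)ᵀ * mJ * (-1) = mJ by simp)
  · rw [Subgroup.zpowers_le]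
    exact (show N2ᵀ * mJ * N2 = mJ by decide +kernel)
  · rw [Subgroup.zpowers_le]
    exact (show RHOᵀ * mJ * RHO = mJ by decide +kernel)

/-- Integer vectors. -/
abbrev V := Fin 5 → ℤ

/-- `v` can be moved to `w` by an element of `H4` fixing the vectors in `S`. -/
def Rel (S : Set V) (v w : V) : Prop :=
  ∃ g ∈ H4, (∀ u ∈ S, (g : Mt) *ᵥ u = u) ∧ (g : Mt) *ᵥ v = w

lemma Rel.refl (S : Set V) (v : V) : Rel S v v :=
  ⟨1, H4.one_mem, by simp, by simp⟩

lemma Rel.trans {S : Set V} {u v w : V} (h : Rel S u v) (h' : Rel S v w) : Rel S u w := by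
  obtain ⟨g, hg, hS, rfl⟩ := h
  obtain ⟨k, hk, hS', rfl⟩ := h'
  refine ⟨k * g, H4.mul_mem hk hg, ?_, ?_⟩
  · intro x hx
    rw [Units.val_mul, ← Matrix.mulVec_mulVec, hS x hx, hS' x hx]
  · rw [Units.val_mul, ← Matrix.mulVec_mulVec]

lemma Rel.symm {S : Set V} {v w : V} (h : Rel S v w) : Rel S w v := by
  obtain ⟨g, hg, hS, rfl⟩ := h
  have key : ∀ x : V, ((g⁻¹ : GLZ) : Mt) *ᵥ ((g : Mt) *ᵥ x) = x := by
    intro x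
    rw [Matrix.mulVec_mulVec, Units.inv_mul, Matrix.one_mulVec]
  refine ⟨g⁻¹, H4.inv_mem hg, ?_, key v⟩
  intro x hx
  conv_lhs => rw [← hS x hx]
  exact key x

lemma Rel.of {S : Set V} {M : Mt} (h : InS H4 M) (hS : ∀ u ∈ S, M *ᵥ u = u) (v : V) :
    Rel S v (M *ᵥ v) := by
  obtain ⟨g, hg, rfl⟩ := h
  exact ⟨g, hg, hS, rfl⟩

lemma Rel.iter {S : Set V} (f : ℤ → V → V) (h1 : ∀ v, Rel S v (f 1 v)) (h0 : ∀ v, f 0 v = v)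
    (hadd : ∀ k v, f (k + 1) v = f 1 (f k v)) (k : ℤ) (v : V) : Rel S v (f k v) := by
  induction k using Int.induction_on with
  | zero => rw [h0]; exact Rel.refl S v
  | succ k ih => rw [hadd]; exact ih.trans (h1 _)
  | pred k ih =>
    have h := h1 (f (-(k : ℤ) - 1) v)
    rw [← hadd, sub_add_cancel] at h
    exact ih.trans h.symm

/-- First basis vector. -/
def ve1 : V := ![1, 0, 0, 0, 0]
/-- Second basis vector. -/
def vf1 : V := ![0, 1, 0, 0, 0]
/-- Third basis vector. -/
def ve2 : V := ![0, 0, 1, 0, 0]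
/-- Fourth basis vector. -/
def vf2 : V := ![0, 0, 0, 1, 0]
/-- Fifth basis vector. -/
def vw : V := ![0, 0, 0, 0, 1]

lemma vec5 (v : V) : v = ![v 0, v 1, v 2, v 3, v 4] := by
  ext i; fin_cases i <;> rfl

lemma mv_X (v : V) : X *ᵥ v = ![v 0 - v 3, v 1, v 2 + v 1, v 3, v 4] := by
  ext i; fin_cases i <;> simp [X, Matrix.mulVec, dotProduct, Fin.sum_univ_five] <;> ring
lemma mv_E1F2 (v : V) : E1F2 *ᵥ v = ![v 0 - v 2, v 1, v 2, v 3 + v 1, v 4] := by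
  ext i; fin_cases i <;> simp [E1F2, Matrix.mulVec, dotProduct, Fin.sum_univ_five] <;> ring
lemma mv_F1E2 (v : V) : F1E2 *ᵥ v = ![v 0, v 1 - v 3, v 2 + v 0, v 3, v 4] := by
  ext i; fin_cases i <;> simp [F1E2, Matrix.mulVec, dotProduct, Fin.sum_univ_five] <;> ring
lemma mv_F1F2 (v : V) : F1F2 *ᵥ v = ![v 0, v 1 - v 2, v 2, v 3 + v 0, v 4] := by
  ext i; fin_cases i <;> simp [F1F2, Matrix.mulVec, dotProduct, Fin.sum_univ_five] <;> ring
lemma mv_E1W (v : V) : E1W *ᵥ v = ![v 0 - 24 * v 4 - 12 * v 1, v 1, v 2, v 3, v 4 + v 1] := by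
  ext i; fin_cases i <;> simp [E1W, Matrix.mulVec, dotProduct, Fin.sum_univ_five] <;> ring
lemma mv_F1W (v : V) : F1W *ᵥ v = ![v 0, v 1 - 24 * v 4 - 12 * v 0, v 2, v 3, v 4 + v 0] := by
  ext i; fin_cases i <;> simp [F1W, Matrix.mulVec, dotProduct, Fin.sum_univ_five] <;> ring
lemma mv_E2W (v : V) : E2W *ᵥ v = ![v 0, v 1, v 2 - 24 * v 4 - 12 * v 3, v 3, v 4 + v 3] := by
  ext i; fin_cases i <;> simp [E2W, Matrix.mulVec, dotProduct, Fin.sum_univ_five] <;> ring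
lemma mv_R1 (v : V) : R1 *ᵥ v = ![v 0, v 1, -v 3, -v 2, v 4] := by
  ext i; fin_cases i <;> simp [R1, Matrix.mulVec, dotProduct, Fin.sum_univ_five]
lemma mv_N2 (v : V) : N2 *ᵥ v = ![v 0, v 1, v 3, v 2, v 4] := by
  ext i; fin_cases i <;> simp [N2, Matrix.mulVec, dotProduct, Fin.sum_univ_five]
lemma mv_RW (v : V) : RW *ᵥ v = ![v 0, v 1, v 2, v 3, -v 4] := by
  ext i; fin_cases i <;> simp [RW, Matrix.mulVec, dotProduct, Fin.sum_univ_five]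
lemma mv_RHO (v : V) : RHO *ᵥ v = ![v 0, v 1, 4 * v 2 - 3 * v 3 - 24 * v 4,
    4 * v 3 - 3 * v 2 + 24 * v 4, v 2 - v 3 - 7 * v 4] := by
  ext i; fin_cases i <;> simp [RHO, Matrix.mulVec, dotProduct, Fin.sum_univ_five] <;> ring

/-! Moves with an integer parameter. -/

lemma move_X {S : Set V} (hS : ∀ u ∈ S, X *ᵥ u = u) (k a b c d n : ℤ) :
    Rel S ![a, b, c, d, n] ![a - k * d, b, c + k * b, d, n] :=
  Rel.iter (fun k v => ![v 0 - k * v 3, v 1, v 2 + k * v 1, v 3, v 4])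
    (fun v => by simpa [mv_X] using Rel.of (X_mem.mono H1_le_H4) hS v)
    (fun v => by simpa using (vec5 v).symm)
    (fun k v => by ext i; fin_cases i <;> simp <;> ring) k ![a, b, c, d, n]

lemma move_E1F2 {S : Set V} (hS : ∀ u ∈ S, E1F2 *ᵥ u = u) (k a b c d n : ℤ) :
    Rel S ![a, b, c, d, n] ![a - k * c, b, c, d + k * b, n] :=
  Rel.iter (fun k v => ![v 0 - k * v 2, v 1, v 2, v 3 + k * v 1, v 4])
    (fun v => by simpa [mv_E1F2] using Rel.of (E1F2_mem.mono H1_le_H4) hS v)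
    (fun v => by simpa using (vec5 v).symm)
    (fun k v => by ext i; fin_cases i <;> simp <;> ring) k ![a, b, c, d, n]

lemma move_F1E2 {S : Set V} (hS : ∀ u ∈ S, F1E2 *ᵥ u = u) (k a b c d n : ℤ) :
    Rel S ![a, b, c, d, n] ![a, b - k * d, c + k * a, d, n] :=
  Rel.iter (fun k v => ![v 0, v 1 - k * v 3, v 2 + k * v 0, v 3, v 4])
    (fun v => by simpa [mv_F1E2] using Rel.of (F1E2_mem.mono H1_le_H4) hS v)
    (fun v => by simpa using (vec5 v).symm)
    (fun k v => by ext i; fin_cases i <;> simp <;> ring) k ![a, b, c, d, n]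

lemma move_F1F2 {S : Set V} (hS : ∀ u ∈ S, F1F2 *ᵥ u = u) (k a b c d n : ℤ) :
    Rel S ![a, b, c, d, n] ![a, b - k * c, c, d + k * a, n] :=
  Rel.iter (fun k v => ![v 0, v 1 - k * v 2, v 2, v 3 + k * v 0, v 4])
    (fun v => by simpa [mv_F1F2] using Rel.of (F1F2_mem.mono H1_le_H4) hS v)
    (fun v => by simpa using (vec5 v).symm)
    (fun k v => by ext i; fin_cases i <;> simp <;> ring) k ![a, b, c, d, n]

lemma move_E1W {S : Set V} (hS : ∀ u ∈ S, E1W *ᵥ u = u) (k a b c d n : ℤ) :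
    Rel S ![a, b, c, d, n] ![a - 24 * k * n - 12 * k ^ 2 * b, b, c, d, n + k * b] :=
  Rel.iter (fun k v => ![v 0 - 24 * k * v 4 - 12 * k ^ 2 * v 1, v 1, v 2, v 3, v 4 + k * v 1])
    (fun v => by simpa [mv_E1W] using Rel.of (E1W_mem.mono W_le_H4) hS v)
    (fun v => by simpa using (vec5 v).symm)
    (fun k v => by ext i; fin_cases i <;> simp <;> ring) k ![a, b, c, d, n]

lemma move_F1W {S : Set V} (hS : ∀ u ∈ S, F1W *ᵥ u = u) (k a b c d n : ℤ) :
    Rel S ![a, b, c, d, n] ![a, b - 24 * k * n - 12 * k ^ 2 * a, c, d, n + k * a] :=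
  Rel.iter (fun k v => ![v 0, v 1 - 24 * k * v 4 - 12 * k ^ 2 * v 0, v 2, v 3, v 4 + k * v 0])
    (fun v => by simpa [mv_F1W] using Rel.of (F1W_mem.mono W_le_H4) hS v)
    (fun v => by simpa using (vec5 v).symm)
    (fun k v => by ext i; fin_cases i <;> simp <;> ring) k ![a, b, c, d, n]

lemma move_E2W {S : Set V} (hS : ∀ u ∈ S, E2W *ᵥ u = u) (k a b c d n : ℤ) :
    Rel S ![a, b, c, d, n] ![a, b, c - 24 * k * n - 12 * k ^ 2 * d, d, n + k * d] :=
  Rel.iter (fun k v => ![v 0, v 1, v 2 - 24 * k * v 4 - 12 * k ^ 2 * v 3, v 3, v 4 + k * v 3])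
    (fun v => by simpa [mv_E2W] using Rel.of (E2W_mem.mono W_le_H4) hS v)
    (fun v => by simpa using (vec5 v).symm)
    (fun k v => by ext i; fin_cases i <;> simp <;> ring) k ![a, b, c, d, n]

lemma move_R1 {S : Set V} (hS : ∀ u ∈ S, R1 *ᵥ u = u) (a b c d n : ℤ) :
    Rel S ![a, b, c, d, n] ![a, b, -d, -c, n] := by
  simpa [mv_R1] using Rel.of (r1.mono W_le_H4) hS ![a, b, c, d, n]

lemma move_N2 {S : Set V} (hS : ∀ u ∈ S, N2 *ᵥ u = u) (a b c d n : ℤ) :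
    Rel S ![a, b, c, d, n] ![a, b, d, c, n] := by
  simpa [mv_N2] using Rel.of (N2_mem.mono H3_le_H4) hS ![a, b, c, d, n]

lemma move_RW {S : Set V} (hS : ∀ u ∈ S, RW *ᵥ u = u) (a b c d n : ℤ) :
    Rel S ![a, b, c, d, n] ![a, b, c, d, -n] := by
  simpa [mv_RW] using Rel.of (RW_mem.mono H3_le_H4) hS ![a, b, c, d, n]

lemma move_RHO {S : Set V} (hS : ∀ u ∈ S, RHO *ᵥ u = u) (a b c d n : ℤ) :
    Rel S ![a, b, c, d, n] ![a, b, 4 * c - 3 * d - 24 * n, 4 * d - 3 * c + 24 * n,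
      c - d - 7 * n] := by
  simpa [mv_RHO] using Rel.of RHO_mem hS ![a, b, c, d, n]

/-! #### The bilinear form -/

/-- The bilinear form with matrix `mJ`. -/
def Bf (v w : V) : ℤ := v 0 * w 1 + v 1 * w 0 + v 2 * w 3 + v 3 * w 2 + 24 * v 4 * w 4

lemma Bf_eq (v w : V) : Bf v w = v ⬝ᵥ (mJ *ᵥ w) := by
  simp [Bf, mJ, Matrix.mulVec, dotProduct, Fin.sum_univ_five]
  ring

lemma Bf_map {g : GLZ} (hg : g ∈ orthogonalSubgroup mJ) (v w : V) :
    Bf ((g : Mt) *ᵥ v) ((g : Mt) *ᵥ w) = Bf v w := by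
  have h : (g : Mt)ᵀ * mJ * (g : Mt) = mJ := hg
  rw [Bf_eq, Bf_eq, ← Matrix.vecMul_transpose, ← Matrix.dotProduct_mulVec,
    Matrix.mulVec_mulVec, Matrix.mulVec_mulVec, h]

lemma Rel.Bf {S : Set V} {v w : V} (h : Rel S v w) : Bf w w = Bf v v := by
  obtain ⟨g, hg, -, rfl⟩ := h
  exact Bf_map (H4_le_O hg) v v

/-! #### Reduction of the first basis vector -/

/-- The first four coordinates are coprime. -/
def Cop (a b c d : ℤ) : Prop := ∀ p : ℤ, p ∣ a → p ∣ b → p ∣ c → p ∣ d → p ∣ 1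

lemma Cop.F1E2 {a b c d : ℤ} (h : Cop a b c d) (k : ℤ) : Cop a (b - k * d) (c + k * a) d := by
  intro p h1 h2 h3 h4
  refine h p h1 ?_ ?_ h4
  · have := dvd_add h2 (h4.mul_left k); simpa using this
  · have := dvd_sub h3 (h1.mul_left k); simpa using this

lemma Cop.F1F2 {a b c d : ℤ} (h : Cop a b c d) (k : ℤ) : Cop a (b - k * c) c (d + k * a) := by
  intro p h1 h2 h3 h4
  refine h p h1 ?_ h3 ?_
  · have := dvd_add h2 (h3.mul_left k); simpa using this
  · have := dvd_sub h4 (h1.mul_left k); simpa using this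

lemma Cop.E1F2 {a b c d : ℤ} (h : Cop a b c d) (k : ℤ) : Cop (a - k * c) b c (d + k * b) := by
  intro p h1 h2 h3 h4
  refine h p ?_ h2 h3 ?_
  · have := dvd_add h1 (h3.mul_left k); simpa using this
  · have := dvd_sub h4 (h2.mul_left k); simpa using this

lemma Cop.X {a b c d : ℤ} (h : Cop a b c d) (k : ℤ) : Cop (a - k * d) b (c + k * b) d := by
  intro p h1 h2 h3 h4
  refine h p ?_ h2 ?_ h4
  · have := dvd_add h1 (h4.mul_left k); simpa using this
  · have := dvd_sub h3 (h2.mul_left k); simpa using this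

lemma Cop.R1 {a b c d : ℤ} (h : Cop a b c d) : Cop a b (-d) (-c) := by
  intro p h1 h2 h3 h4
  exact h p h1 h2 ((dvd_neg).1 h4) ((dvd_neg).1 h3)

lemma red (a b c d n : ℤ) (ha : 0 < a) (hc : ¬ a ∣ c) (hcop : Cop a b c d) :
    ∃ a' b' c' d', 0 < a' ∧ a' < a ∧ Cop a' b' c' d' ∧
      Rel ∅ ![a, b, c, d, n] ![a', b', c', d', n] := by
  have m1 := move_F1E2 (S := ∅) (by simp) (-(c / a)) a b c d n
  have c1 := hcop.F1E2 (-(c / a))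
  have hr : c + -(c / a) * a = c % a := by
    have := Int.emod_add_mul_ediv c a; linarith
  rw [hr] at m1 c1
  have h0 : 0 < c % a := lt_of_le_of_ne (Int.emod_nonneg c ha.ne')
    (fun h => hc (Int.dvd_of_emod_eq_zero h.symm))
  have h1 : c % a < a := Int.emod_lt_of_pos c ha
  generalize c % a = r at *
  have m2 := move_E1F2 (S := ∅) (by simp) ((a - 1) / r) a (b - -(c / a) * d) r d n
  have c2 := c1.E1F2 ((a - 1) / r)
  have hj := Int.emod_add_mul_ediv (a - 1) r
  have hj0 := Int.emod_nonneg (a - 1) h0.ne'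
  have hj1 := Int.emod_lt_of_pos (a - 1) h0
  exact ⟨_, _, _, _, by linarith, by linarith, c2, m1.trans m2⟩

lemma stepA (n : ℤ) (m : ℕ) : ∀ a b c d : ℤ, 0 < a → a ≤ m → Cop a b c d →
    ∃ b', Rel ∅ ![a, b, c, d, n] ![1, b', 0, 0, n] := by
  induction m with
  | zero => intro a b c d h h'; norm_cast at h'; omega
  | succ m ih =>
    have fin : ∀ a b c d : ℤ, 0 < a → a ≤ (m + 1 : ℕ) → Cop a b c d → ¬ a ∣ c →
        ∃ b', Rel ∅ ![a, b, c, d, n] ![1, b', 0, 0, n] := by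
      intro a b c d ha hm hcop hc
      obtain ⟨a', b', c', d', h0, h1, h2, h3⟩ := red a b c d n ha hc hcop
      obtain ⟨b'', h⟩ := ih a' b' c' d' h0 (by push_cast at hm; omega) h2
      exact ⟨b'', h3.trans h⟩
    intro a b c d ha hm hcop
    by_cases hc : a ∣ c
    swap
    · exact fin a b c d ha hm hcop hc
    obtain ⟨t, rfl⟩ := hc
    have m1 := move_F1E2 (S := ∅) (by simp) (-t) a b (a * t) d n
    have c1 := hcop.F1E2 (-t)
    have e1 : a * t + -t * a = 0 := by ring
    rw [e1] at m1 c1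
    generalize b - -t * d = b1 at m1 c1
    by_cases hd : a ∣ d
    swap
    · obtain ⟨b', h⟩ := fin a b1 (-d) (-0) ha hm c1.R1 (by rwa [dvd_neg])
      exact ⟨b', (m1.trans (move_R1 (S := ∅) (by simp) a b1 0 d n)).trans h⟩
    obtain ⟨s, rfl⟩ := hd
    have m2 := move_F1F2 (S := ∅) (by simp) (-s) a b1 0 (a * s) n
    have c2 := c1.F1F2 (-s)
    have e2 : a * s + -s * a = 0 := by ring
    rw [e2] at m2 c2
    generalize b1 - -s * 0 = b2 at m2 c2
    have m12 := m1.trans m2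
    by_cases h1 : a = 1
    · subst h1
      exact ⟨b2, m12⟩
    have hb : ¬ a ∣ b2 := by
      intro hb
      have := Int.eq_one_of_dvd_one ha.le (c2 a dvd_rfl hb (dvd_zero a) (dvd_zero a))
      exact h1 this
    have m3 := move_X (S := ∅) (by simp) 1 a b2 0 0 n
    have c3 := c2.X 1
    have e3 : a - 1 * 0 = a := by ring
    have e4 : 0 + 1 * b2 = b2 := by ring
    rw [e3, e4] at m3 c3
    obtain ⟨b', h⟩ := fin a b2 b2 0 ha hm c3 hb
    exact ⟨b', (m12.trans m3).trans h⟩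

lemma start_c (a b c d n : ℤ) (hc : c ≠ 0) (hcop : Cop a b c d) :
    ∃ a' b' c' d', 0 < a' ∧ Cop a' b' c' d' ∧ Rel ∅ ![a, b, c, d, n] ![a', b', c', d', n] := by
  refine ⟨_, _, _, _, ?_, hcop.E1F2 (-(|a| + 1) * c), move_E1F2 (S := ∅) (by simp) _ a b c d n⟩
  have h1 : 1 ≤ c * c := by
    have : 0 < c * c := mul_self_pos.2 hc
    omega
  have h2 := neg_abs_le a
  nlinarith [abs_nonneg a]

lemma start (a b c d n : ℤ) (hcop : Cop a b c d) :
    ∃ a' b' c' d', 0 < a' ∧ Cop a' b' c' d' ∧ Rel ∅ ![a, b, c, d, n] ![a', b', c', d', n] := by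
  by_cases hc : c = 0
  swap
  · exact start_c a b c d n hc hcop
  by_cases hd : d = 0
  swap
  · obtain ⟨a', b', c', d', h0, h1, h2⟩ := start_c a b (-d) (-c) n (by simpa using hd) hcop.R1
    exact ⟨a', b', c', d', h0, h1, (move_R1 (S := ∅) (by simp) a b c d n).trans h2⟩
  subst hc hd
  by_cases hb : b = 0
  swap
  · obtain ⟨a', b', c', d', h0, h1, h2⟩ := start_c (a - 1 * 0) b (0 + 1 * b) 0 n
      (by simpa using hb) (hcop.X 1)
    exact ⟨a', b', c', d', h0, h1, (move_X (S := ∅) (by simp) 1 a b 0 0 n).trans h2⟩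
  subst hb
  have ha : a ≠ 0 := by
    rintro rfl
    have := hcop 0 dvd_rfl dvd_rfl dvd_rfl dvd_rfl
    omega
  obtain ⟨a', b', c', d', h0, h1, h2⟩ := start_c a (0 - 1 * 0) (0 + 1 * a) 0 n
    (by simpa using ha) (hcop.F1E2 1)
  exact ⟨a', b', c', d', h0, h1, (move_F1E2 (S := ∅) (by simp) 1 a 0 0 0 n).trans h2⟩

lemma step1 {g : GLZ} (hg : g ∈ orthogonalSubgroup mJ) : Rel ∅ ((g : Mt) *ᵥ ve1) ve1 := by
  have hq := Bf_map hg ve1 ve1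
  have hp := Bf_map hg ve1 vf1
  generalize (g : Mt) *ᵥ ve1 = v at *
  generalize (g : Mt) *ᵥ vf1 = w at *
  rw [vec5 v] at hq ⊢
  have e0 : Bf ve1 ve1 = 0 := by decide
  have e1 : Bf ve1 vf1 = 1 := by decide
  rw [e0] at hq
  rw [e1] at hp
  have hcop : Cop (v 0) (v 1) (v 2) (v 3) := by
    intro p h0 h1 h2 h3
    have hn : p ∣ 12 * v 4 := by
      rw [← Int.pow_dvd_pow_iff (n := 2) (by norm_num)]
      have h01 : p ^ 2 ∣ v 0 * v 1 := by rw [pow_two]; exact mul_dvd_mul h0 h1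
      have h23 : p ^ 2 ∣ v 2 * v 3 := by rw [pow_two]; exact mul_dvd_mul h2 h3
      have : (12 * v 4) ^ 2 = -12 * (v 0 * v 1) + -12 * (v 2 * v 3) := by
        simp [Bf] at hq
        linarith
      rw [this]
      exact dvd_add (h01.mul_left _) (h23.mul_left _)
    rw [← hp]
    have e : Bf v w = v 0 * w 1 + v 1 * w 0 + v 2 * w 3 + v 3 * w 2 + (12 * v 4) * (2 * w 4) := by
      rw [Bf]; ring
    rw [e]
    exact dvd_add (dvd_add (dvd_add (dvd_add (h0.mul_right _) (h1.mul_right _))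
      (h2.mul_right _)) (h3.mul_right _)) (hn.mul_right _)
  obtain ⟨a', b', c', d', h0, h1, h2⟩ := start _ _ _ _ (v 4) hcop
  obtain ⟨b, h⟩ := stepA (v 4) a'.toNat a' b' c' d' h0 (by omega) h1
  have h3 := h2.trans h
  have h4 := h3.Bf
  rw [hq] at h4
  have hb : b = -12 * v 4 ^ 2 := by
    simp [Bf] at h4
    linarith
  have m := move_F1W (S := ∅) (by simp) (-v 4) 1 b 0 0 (v 4)
  have e : (![1, b - 24 * -v 4 * v 4 - 12 * (-v 4) ^ 2 * 1, 0, 0, v 4 + -v 4 * 1] : V) = ve1 := by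
    rw [hb, ve1]
    ext i; fin_cases i <;> simp
    ring
  rw [e] at m
  exact h3.trans m

/-! #### Reduction of the other basis vectors -/

/-- Fixed vectors, first stage. -/
def T1 : Set V := insert ve1 ∅
/-- Fixed vectors, second stage. -/
def T2 : Set V := insert vf1 T1
/-- Fixed vectors, third stage. -/
def T3 : Set V := insert ve2 T2
/-- Fixed vectors, fourth stage. -/
def T4 : Set V := insert vf2 T3

lemma fix1 {M : Mt} (h1 : M *ᵥ ve1 = ve1) : ∀ u ∈ T1, M *ᵥ u = u := by
  rintro u (rfl | h)
  · exact h1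
  · exact h.elim
lemma fix2 {M : Mt} (h1 : M *ᵥ ve1 = ve1) (h2 : M *ᵥ vf1 = vf1) : ∀ u ∈ T2, M *ᵥ u = u := by
  rintro u (rfl | h)
  · exact h2
  · exact fix1 h1 u h
lemma fix3 {M : Mt} (h1 : M *ᵥ ve1 = ve1) (h2 : M *ᵥ vf1 = vf1) (h3 : M *ᵥ ve2 = ve2) :
    ∀ u ∈ T3, M *ᵥ u = u := by
  rintro u (rfl | h)
  · exact h3
  · exact fix2 h1 h2 u h
lemma fix4 {M : Mt} (h1 : M *ᵥ ve1 = ve1) (h2 : M *ᵥ vf1 = vf1) (h3 : M *ᵥ ve2 = ve2)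
    (h4 : M *ᵥ vf2 = vf2) : ∀ u ∈ T4, M *ᵥ u = u := by
  rintro u (rfl | h)
  · exact h4
  · exact fix3 h1 h2 h3 u h

lemma extend {S : Set V} {v : V} {g : GLZ} (hg : g ∈ orthogonalSubgroup mJ)
    (hS : ∀ u ∈ S, (g : Mt) *ᵥ u = u) (h : Rel S ((g : Mt) *ᵥ v) v) :
    ∃ γ ∈ H4, γ * g ∈ orthogonalSubgroup mJ ∧
      ∀ u ∈ insert v S, ((γ * g : GLZ) : Mt) *ᵥ u = u := by
  obtain ⟨γ, hγ, h1, h2⟩ := h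
  refine ⟨γ, hγ, Subgroup.mul_mem _ (H4_le_O hγ) hg, ?_⟩
  rintro u (rfl | hu)
  · rw [Units.val_mul, ← Matrix.mulVec_mulVec, h2]
  · rw [Units.val_mul, ← Matrix.mulVec_mulVec, hS u hu, h1 u hu]

lemma step2 {g : GLZ} (hg : g ∈ orthogonalSubgroup mJ) (hS : ∀ u ∈ T1, (g : Mt) *ᵥ u = u) :
    Rel T1 ((g : Mt) *ᵥ vf1) vf1 := by
  have f1 := hS ve1 (Or.inl rfl)
  have hq := Bf_map hg vf1 vf1
  have hp := Bf_map hg vf1 ve1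
  rw [f1] at hp
  generalize (g : Mt) *ᵥ vf1 = v at *
  rw [vec5 v]
  simp [Bf, ve1, vf1] at hq hp
  have m1 := move_X (S := T1) (fix1 (by decide +kernel)) (-v 2) (v 0) (v 1) (v 2) (v 3) (v 4)
  have m2 := m1.trans (move_E1F2 (S := T1) (fix1 (by decide +kernel)) (-v 3) _ _ _ _ _)
  have m3 := m2.trans (move_E1W (S := T1) (fix1 (by decide +kernel)) (-v 4) _ _ _ _ _)
  convert m3 using 1
  rw [vf1]
  rw [hp] at hq ⊢
  ext i; fin_cases i <;> simp
  linarith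

lemma dvd_of_eq_of_dvd {p x y : ℤ} (h : p ∣ y) (e : x = y) : p ∣ x := e ▸ h

/-- Coprimality in the three-dimensional lattice. -/
def Cop3 (c d n : ℤ) : Prop := ∀ p : ℤ, p ∣ c → p ∣ d → p ∣ 24 * n → p ∣ 1

lemma move_neg (c d n : ℤ) : Rel T2 ![0, 0, c, d, n] ![0, 0, -c, -d, n] :=
  (move_R1 (S := T2) (fix2 (by decide +kernel) (by decide +kernel)) 0 0 c d n).trans
    (move_N2 (S := T2) (fix2 (by decide +kernel) (by decide +kernel)) 0 0 _ _ n)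

lemma reach_zero (c n : ℤ) (hq : c * 0 + 12 * n ^ 2 = 0) (hcop : Cop3 c 0 n) :
    Rel T2 ![0, 0, c, 0, n] ve2 := by
  have hn : n = 0 := by simpa using hq
  subst hn
  have hc := hcop c dvd_rfl (dvd_zero c) (by simp)
  rcases Int.isUnit_iff.1 (isUnit_of_dvd_one hc) with rfl | rfl
  · exact Rel.refl _ _
  · exact move_neg (-1) 0 0

lemma reach (m : ℕ) : ∀ c d n : ℤ, |d| ≤ m → c * d + 12 * n ^ 2 = 0 → Cop3 c d n →
    Rel T2 ![0, 0, c, d, n] ve2 := by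
  induction m with
  | zero =>
    intro c d n hd hq hcop
    have : d = 0 := by simpa using hd
    subst this
    exact reach_zero c n hq hcop
  | succ m ih =>
    have core : ∀ c d n : ℤ, 0 < d → d ≤ m + 1 → -d ≤ 2 * n → n ≤ 0 →
        c * d + 12 * n ^ 2 = 0 → Cop3 c d n → Rel T2 ![0, 0, c, d, n] ve2 := by
      intro c d n hd0 hdm hn1 hn0 hq hcop
      by_cases hc : |c| < d
      · refine (move_N2 (S := T2) (fix2 (by decide +kernel) (by decide +kernel)) 0 0 c d n).trans
          (ih d c n (by omega) (by linarith) (fun p h1 h2 h3 => hcop p h2 h1 h3))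
      · have hc' : c ≤ -d := by
          rcases le_abs.1 (not_lt.1 hc) with h | h
          · nlinarith [sq_nonneg n]
          · linarith
        have h12 : d ^ 2 ≤ 12 * n ^ 2 := by nlinarith
        have hne : -d ≠ 2 * n := by
          intro h
          have hd : d = -2 * n := by linarith
          subst hd
          have hc3 : c = 6 * n := by
            have : (-2 * n) * (c - 6 * n) = 0 := by linarith
            rcases mul_eq_zero.1 this with h | h
            · omega
            · linarith
          have h1 := hcop (-2 * n) ⟨-3, by rw [hc3]; ring⟩ dvd_rfl ⟨-12, by ring⟩
          have := Int.eq_one_of_dvd_one hd0.le h1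
          omega
        have hlt : -d < 2 * n := lt_of_le_of_ne hn1 hne
        have hs : d * (4 * d - 3 * c + 24 * n) = (2 * d + 6 * n) ^ 2 := by
          linear_combination (-3) * hq
        have h6 : 6 * n < -d := by nlinarith
        have hs2 : (2 * d + 6 * n) ^ 2 < d ^ 2 := by
          apply sq_lt_sq' <;> linarith
        have hd'0 : 0 ≤ 4 * d - 3 * c + 24 * n := by
          by_contra h
          push Not at h
          nlinarith [sq_nonneg (2 * d + 6 * n)]
        have hd'1 : 4 * d - 3 * c + 24 * n < d := by
          by_contra h
          push Not at h
          nlinarith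
        refine (move_RHO (S := T2) (fix2 (by decide +kernel) (by decide +kernel)) 0 0 c d n).trans
          (ih _ _ _ (by rw [abs_of_nonneg hd'0]; omega) (by linear_combination hq) ?_)
        intro p h1 h2 h3
        refine hcop p ?_ ?_ ?_
        · have := dvd_sub (dvd_sub (h1.mul_left 4) (h2.mul_left 3)) h3
          exact dvd_of_eq_of_dvd this (by ring)
        · have := dvd_add (dvd_sub (h2.mul_left 4) (h1.mul_left 3)) h3
          exact dvd_of_eq_of_dvd this (by ring)
        · have := dvd_sub (dvd_sub (h1.mul_left 24) (h2.mul_left 24)) (h3.mul_left 7)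
          exact dvd_of_eq_of_dvd this (by ring)
    have core2 : ∀ c d n : ℤ, 0 < d → d ≤ m + 1 →
        c * d + 12 * n ^ 2 = 0 → Cop3 c d n → Rel T2 ![0, 0, c, d, n] ve2 := by
      intro c d n hd0 hdm hq hcop
      have m1 := move_E2W (S := T2) (fix2 (by decide +kernel) (by decide +kernel))
        (-((2 * n + d) / (2 * d))) 0 0 c d n
      have e := Int.emod_add_mul_ediv (2 * n + d) (2 * d)
      have e0 := Int.emod_nonneg (2 * n + d) (show 2 * d ≠ 0 by omega)
      have e1 := Int.emod_lt_of_pos (2 * n + d) (show 0 < 2 * d by omega)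
      generalize (2 * n + d) / (2 * d) = t at *
      generalize (2 * n + d) % (2 * d) = r at *
      refine m1.trans ?_
      have hn1 : -d ≤ 2 * (n + -t * d) := by linarith
      have hn2 : 2 * (n + -t * d) < d := by linarith
      have hq' : (c - 24 * -t * n - 12 * (-t) ^ 2 * d) * d + 12 * (n + -t * d) ^ 2 = 0 := by
        linear_combination hq
      have hcop' : Cop3 (c - 24 * -t * n - 12 * (-t) ^ 2 * d) d (n + -t * d) := by
        intro p h1 h2 h3
        have h4 : p ∣ 24 * n := by
          have := dvd_add h3 (h2.mul_left (24 * t))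
          exact dvd_of_eq_of_dvd this (by ring)
        refine hcop p ?_ h2 h4
        have := dvd_add (dvd_sub h1 (h4.mul_left t)) (h2.mul_left (12 * t ^ 2))
        exact dvd_of_eq_of_dvd this (by ring)
      generalize c - 24 * -t * n - 12 * (-t) ^ 2 * d = c' at *
      generalize n + -t * d = n' at *
      by_cases hn : n' ≤ 0
      · exact core c' d n' hd0 hdm hn1 hn hq' hcop'
      · refine (move_RW (S := T2) (fix2 (by decide +kernel) (by decide +kernel)) 0 0 c' d n').trans
          (core c' d (-n') hd0 hdm (by omega) (by omega) (by linear_combination hq') ?_)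
        intro p h1 h2 h3
        refine hcop' p h1 h2 ?_
        rw [← dvd_neg]
        exact dvd_of_eq_of_dvd h3 (by ring)
    intro c d n hd hq hcop
    push_cast at hd
    rcases lt_trichotomy d 0 with h | rfl | h
    · refine (move_neg c d n).trans (core2 (-c) (-d) n (by omega) ?_ (by linarith) ?_)
      · exact (neg_le_abs d).trans hd
      · exact fun p h1 h2 h3 => hcop p (dvd_neg.1 h1) (dvd_neg.1 h2) h3
    · exact reach_zero c n hq hcop
    · exact core2 c d n h ((le_abs_self d).trans hd) hq hcop

lemma step3 {g : GLZ} (hg : g ∈ orthogonalSubgroup mJ) (hS : ∀ u ∈ T2, (g : Mt) *ᵥ u = u) :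
    Rel T2 ((g : Mt) *ᵥ ve2) ve2 := by
  have f1 := hS ve1 (Or.inr (Or.inl rfl))
  have f2 := hS vf1 (Or.inl rfl)
  have hq := Bf_map hg ve2 ve2
  have hp := Bf_map hg ve2 vf2
  have h1 := Bf_map hg ve2 ve1
  have h2 := Bf_map hg ve2 vf1
  rw [f1] at h1
  rw [f2] at h2
  generalize (g : Mt) *ᵥ ve2 = v at *
  generalize (g : Mt) *ᵥ vf2 = w at *
  rw [vec5 v]
  simp [Bf, ve1, vf1] at h1 h2
  simp [Bf, ve1, vf1, ve2, vf2, h1, h2] at hq hp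
  simp [ve2] at h1 h2
  rw [h1, h2]
  refine reach (v 3).natAbs (v 2) (v 3) (v 4) (by simp) (by linarith) ?_
  intro p a1 a2 a3
  rw [← hp]
  exact dvd_add (dvd_add (a1.mul_right _) (a2.mul_right _)) (a3.mul_right _)

lemma step4 {g : GLZ} (hg : g ∈ orthogonalSubgroup mJ) (hS : ∀ u ∈ T3, (g : Mt) *ᵥ u = u) :
    Rel T3 ((g : Mt) *ᵥ vf2) vf2 := by
  have f1 := hS ve1 (Or.inr (Or.inr (Or.inl rfl)))
  have f2 := hS vf1 (Or.inr (Or.inl rfl))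
  have f3 := hS ve2 (Or.inl rfl)
  have hq := Bf_map hg vf2 vf2
  have h1 := Bf_map hg vf2 ve1
  have h2 := Bf_map hg vf2 vf1
  have h3 := Bf_map hg vf2 ve2
  rw [f1] at h1
  rw [f2] at h2
  rw [f3] at h3
  generalize (g : Mt) *ᵥ vf2 = v at *
  rw [vec5 v]
  simp [Bf, ve1, vf1, ve2, vf2] at h1 h2 h3 hq
  rw [h1, h2, h3]
  have m := move_E2W (S := T3) (fix3 (by decide +kernel) (by decide +kernel) (by decide +kernel))
    (-v 4) 0 0 (v 2) 1 (v 4)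
  convert m using 1
  rw [h1, h2, h3] at hq
  rw [vf2]
  ext i; fin_cases i <;> simp
  linarith

lemma step5 {g : GLZ} (hg : g ∈ orthogonalSubgroup mJ) (hS : ∀ u ∈ T4, (g : Mt) *ᵥ u = u) :
    Rel T4 ((g : Mt) *ᵥ vw) vw := by
  have f1 := hS ve1 (Or.inr (Or.inr (Or.inr (Or.inl rfl))))
  have f2 := hS vf1 (Or.inr (Or.inr (Or.inl rfl)))
  have f3 := hS ve2 (Or.inr (Or.inl rfl))
  have f4 := hS vf2 (Or.inl rfl)
  have hq := Bf_map hg vw vw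
  have h1 := Bf_map hg vw ve1
  have h2 := Bf_map hg vw vf1
  have h3 := Bf_map hg vw ve2
  have h4 := Bf_map hg vw vf2
  rw [f1] at h1
  rw [f2] at h2
  rw [f3] at h3
  rw [f4] at h4
  generalize (g : Mt) *ᵥ vw = v at *
  rw [vec5 v]
  simp [Bf, ve1, vf1, ve2, vf2, vw] at h1 h2 h3 h4 hq
  rw [h1, h2, h3, h4] at hq ⊢
  have h5 : v 4 * v 4 = 1 := by linarith
  rcases mul_self_eq_one_iff.1 h5 with h | h
  · rw [h]; exact Rel.refl _ _
  · rw [h]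
    exact move_RW (S := T4) (fix4 (by decide +kernel) (by decide +kernel) (by decide +kernel)
      (by decide +kernel)) 0 0 0 0 (-1)

lemma O_le_H4 : orthogonalSubgroup mJ ≤ H4 := by
  intro g hg
  obtain ⟨γ1, k1, o1, s1⟩ := extend hg (S := ∅) (by simp) (step1 hg)
  obtain ⟨γ2, k2, o2, s2⟩ := extend o1 s1 (step2 o1 s1)
  obtain ⟨γ3, k3, o3, s3⟩ := extend o2 s2 (step3 o2 s2)
  obtain ⟨γ4, k4, o4, s4⟩ := extend o3 s3 (step4 o3 s3)
  obtain ⟨γ5, k5, o5, s5⟩ := extend o4 s4 (step5 o4 s4)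
  have e : γ5 * (γ4 * (γ3 * (γ2 * (γ1 * g)))) = 1 := by
    generalize γ5 * (γ4 * (γ3 * (γ2 * (γ1 * g)))) = x at *
    have f1 := s5 ve1 (Or.inr (Or.inr (Or.inr (Or.inr (Or.inl rfl)))))
    have f2 := s5 vf1 (Or.inr (Or.inr (Or.inr (Or.inl rfl))))
    have f3 := s5 ve2 (Or.inr (Or.inr (Or.inl rfl)))
    have f4 := s5 vf2 (Or.inr (Or.inl rfl))
    have f5 := s5 vw (Or.inl rfl)
    apply Units.ext
    ext i j
    fin_cases j
    · have := congrFun f1 i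
      simp [ve1, Matrix.mulVec, dotProduct, Fin.sum_univ_five] at this
      simp [this]; fin_cases i <;> rfl
    · have := congrFun f2 i
      simp [vf1, Matrix.mulVec, dotProduct, Fin.sum_univ_five] at this
      simp [this]; fin_cases i <;> rfl
    · have := congrFun f3 i
      simp [ve2, Matrix.mulVec, dotProduct, Fin.sum_univ_five] at this
      simp [this]; fin_cases i <;> rfl
    · have := congrFun f4 i
      simp [vf2, Matrix.mulVec, dotProduct, Fin.sum_univ_five] at this
      simp [this]; fin_cases i <;> rfl
    · have := congrFun f5 i
      simp [vw, Matrix.mulVec, dotProduct, Fin.sum_univ_five] at this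
      simp [this]; fin_cases i <;> rfl
  have e' : g = γ1⁻¹ * (γ2⁻¹ * (γ3⁻¹ * (γ4⁻¹ * γ5⁻¹))) := by
    have : g = γ1⁻¹ * (γ2⁻¹ * (γ3⁻¹ * (γ4⁻¹ * (γ5⁻¹ *
      (γ5 * (γ4 * (γ3 * (γ2 * (γ1 * g))))))))) := by group
    rw [e, mul_one] at this
    exact this
  rw [e']
  exact H4.mul_mem (H4.inv_mem k1) (H4.mul_mem (H4.inv_mem k2) (H4.mul_mem (H4.inv_mem k3)
    (H4.mul_mem (H4.inv_mem k4) (H4.inv_mem k5))))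

/-! ### Transfer to the original form -/

/-- The inverse of `mA`. -/
def mAI : Mt := !![-1, -8, 5, -4, -24; -1, 6, -2, 3, 24; -1, 0, 2, 0, 0; 1, 1, -1, 1, 0; 0, -2, 1, -1, -7]
/-- The inverse of `matA`. -/
def AI : Mt := !![1, 1, 0, 0, 0; -1, 0, 1, 0, 0; 1, 0, 0, 1, 0; -1, 0, 0, 0, 1; 1, 0, 0, 0, 0]
/-- The inverse of `matB`. -/
def BI : Mt := !![-1, 1, 0, 0, 0; -2, 0, 1, 0, 0; -2, 0, 0, 1, 0; -1, 0, 0, 0, 1; -1, 0, 0, 0, 0]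
/-- The Gram matrix `24 Q⁻¹`. -/
def mG : Mt := PIᵀ * mJ * PI

lemma PM_PI : PM * PI = 1 := by decide +kernel
lemma PI_PM : PI * PM = 1 := by decide +kernel

lemma conj_mul (M N : Mt) : PI * M * PM * (PI * N * PM) = PI * (M * N) * PM := by
  calc PI * M * PM * (PI * N * PM) = PI * M * (PM * PI) * N * PM := by simp only [mul_assoc]
    _ = PI * (M * N) * PM := by rw [PM_PI, mul_one, mul_assoc PI M N]

/-- The contragredient followed by the change of basis `PM`. -/
def psi : GLZ →* GLZ where
  toFun g := ⟨PI * ((g⁻¹ : GLZ) : Mt)ᵀ * PM, PI * (g : Mt)ᵀ * PM,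
    by rw [conj_mul, ← Matrix.transpose_mul, Units.mul_inv, Matrix.transpose_one, mul_one, PI_PM],
    by rw [conj_mul, ← Matrix.transpose_mul, Units.inv_mul, Matrix.transpose_one, mul_one, PI_PM]⟩
  map_one' := by
    apply Units.ext
    change PI * ((1⁻¹ : GLZ) : Mt)ᵀ * PM = 1
    rw [inv_one, Units.val_one, Matrix.transpose_one, mul_one, PI_PM]
  map_mul' g h := by
    apply Units.ext
    change PI * (((g * h)⁻¹ : GLZ) : Mt)ᵀ * PM =
      PI * ((g⁻¹ : GLZ) : Mt)ᵀ * PM * (PI * ((h⁻¹ : GLZ) : Mt)ᵀ * PM)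
    rw [conj_mul, ← Matrix.transpose_mul, _root_.mul_inv_rev, Units.val_mul]

lemma psi_val (g : GLZ) : (psi g : Mt) = PI * ((g⁻¹ : GLZ) : Mt)ᵀ * PM := rfl

lemma psi_inj : Function.Injective psi := by
  rw [injective_iff_map_eq_one]
  intro g hg
  have h : PI * ((g⁻¹ : GLZ) : Mt)ᵀ * PM = 1 := by rw [← psi_val, hg]; rfl
  have h2 : ((g⁻¹ : GLZ) : Mt)ᵀ = 1 := by
    calc ((g⁻¹ : GLZ) : Mt)ᵀ = (PM * PI) * ((g⁻¹ : GLZ) : Mt)ᵀ * (PM * PI) := by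
          rw [PM_PI, mul_one, one_mul]
      _ = PM * (PI * ((g⁻¹ : GLZ) : Mt)ᵀ * PM) * PI := by simp only [mul_assoc]
      _ = 1 := by rw [h, mul_one, PM_PI]
  have h3 : g⁻¹ = 1 := by
    apply Units.ext
    have := congrArg Matrix.transpose h2
    rw [Matrix.transpose_transpose, Matrix.transpose_one] at this
    exact this
  exact inv_eq_one.1 h3

lemma psi_map : (orthogonalSubgroup matQ).map psi ≤ orthogonalSubgroup mJ := by
  rintro _ ⟨g, hg, rfl⟩
  have hQ : (g : Mt)ᵀ * matQ * (g : Mt) = matQ := hg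
  change (psi g : Mt)ᵀ * mJ * (psi g : Mt) = mJ
  rw [psi_val]
  have hba : ((g⁻¹ : GLZ) : Mt) * (g : Mt) = 1 := Units.inv_mul g
  have hab : (g : Mt) * ((g⁻¹ : GLZ) : Mt) = 1 := Units.mul_inv g
  generalize (g : Mt) = a at *
  generalize ((g⁻¹ : GLZ) : Mt) = b at *
  have hbt : bᵀ * aᵀ = 1 := by rw [← Matrix.transpose_mul, hab, Matrix.transpose_one]
  have hGQ : mG * matQ = (24 : ℤ) • (1 : Mt) := by decide +kernel
  have hQG : matQ * mG = (24 : ℤ) • (1 : Mt) := by decide +kernel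
  have h1 : matQ * a = bᵀ * matQ := by
    calc matQ * a = (bᵀ * aᵀ) * (matQ * a) := by rw [hbt, one_mul]
      _ = bᵀ * (aᵀ * matQ * a) := by simp only [mul_assoc]
      _ = bᵀ * matQ := by rw [hQ]
  have h2 : (24 : ℤ) • (a * mG) = (24 : ℤ) • (mG * bᵀ) := by
    calc (24 : ℤ) • (a * mG) = ((24 : ℤ) • (1 : Mt)) * (a * mG) := by rw [smul_mul_assoc, one_mul]
      _ = mG * (matQ * a) * mG := by rw [← hGQ]; simp only [mul_assoc]
      _ = mG * bᵀ * (matQ * mG) := by rw [h1]; simp only [mul_assoc]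
      _ = (24 : ℤ) • (mG * bᵀ) := by rw [hQG, mul_smul_comm, mul_one]
  have h3 : a * mG = mG * bᵀ := by
    ext i j
    have := congrFun (congrFun h2 i) j
    simp only [Matrix.smul_apply, smul_eq_mul] at this
    omega
  have hJ : PMᵀ * mG * PM = mJ := by decide +kernel
  calc (PI * bᵀ * PM)ᵀ * mJ * (PI * bᵀ * PM) = PMᵀ * (b * (PIᵀ * mJ * PI * bᵀ)) * PM := by
        simp only [Matrix.transpose_mul, Matrix.transpose_transpose, mul_assoc]
    _ = PMᵀ * (b * (mG * bᵀ)) * PM := rfl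
    _ = mJ := by rw [← h3, ← mul_assoc b, hba, one_mul, hJ]

lemma inv_val {g : GLZ} {M N : Mt} (h : (g : Mt) = M) (e : M * N = 1) :
    ((g⁻¹ : GLZ) : Mt) = N := by
  calc ((g⁻¹ : GLZ) : Mt) = ((g⁻¹ : GLZ) : Mt) * ((g : Mt) * N) := by rw [h, e, mul_one]
    _ = N := by rw [← mul_assoc, Units.inv_mul, one_mul]

lemma W_le_map {A B : GLZ} (hA : (A : Mt) = matA) (hB : (B : Mt) = matB) :
    W ≤ (Subgroup.closure {A, B}).map psi := by
  have a : InS ((Subgroup.closure {A, B}).map psi) mA := by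
    refine ⟨psi A, ⟨A, Subgroup.subset_closure (by simp), rfl⟩, ?_⟩
    rw [psi_val, inv_val (N := AI) hA (by decide +kernel)]
    decide +kernel
  have b : InS ((Subgroup.closure {A, B}).map psi) mB := by
    refine ⟨psi B, ⟨B, Subgroup.subset_closure (by simp), rfl⟩, ?_⟩
    rw [psi_val, inv_val (N := BI) hB (by decide +kernel)]
    decide +kernel
  generalize (Subgroup.closure {A, B}).map psi = K at a b ⊢
  have a' : InS K mAI := a.inv (by decide +kernel)
  have c : ∀ {M N : Mt}, InS K M → mA * M * mAI = N → InS K N :=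
    fun h e => e ▸ (a.mul h).mul a'
  have i0 : InS K R0 := by
    have h := a'.mul b
    rwa [show mAI * mB = R0 by decide +kernel] at h
  have i1 : InS K R1 := c i0 (by decide +kernel)
  have i2 : InS K R2 := c i1 (by decide +kernel)
  have i3 : InS K R3 := c i2 (by decide +kernel)
  have i4 : InS K R4 := c i3 (by decide +kernel)
  have i5 : InS K R5 := c i4 (by decide +kernel)
  rw [W, Subgroup.closure_le]
  rintro g (h | h | h | h | h | h)
  · exact InS.mem (h ▸ i0)
  · exact InS.mem (h ▸ i1)
  · exact InS.mem (h ▸ i2)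
  · exact InS.mem (h ▸ i3)
  · exact InS.mem (h ▸ i4)
  · exact InS.mem (h ▸ i5)

lemma final_index {A B : GLZ} (hA : (A : Mt) = matA) (hB : (B : Mt) = matB) :
    (Subgroup.closure {A, B}).relIndex (orthogonalSubgroup matQ) ≠ 0 := by
  have h1 : W.relIndex ((orthogonalSubgroup matQ).map psi) ≠ 0 := fun h =>
    idx (Subgroup.relIndex_eq_zero_of_le_right (psi_map.trans O_le_H4) h)
  have h2 : ((Subgroup.closure {A, B}).map psi).relIndex
      ((orthogonalSubgroup matQ).map psi) ≠ 0 := fun h =>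
    h1 (Subgroup.relIndex_eq_zero_of_le_left (W_le_map hA hB) h)
  rwa [Subgroup.relIndex_map_map_of_injective _ _ psi_inj] at h2

end HG

/-- Case 10 of Theorem 1.2: the hypergeometric group `Γ(f,g)` generated by the companion matrices `A`, `B`
of `f(x) = x^5 - x^4 + x^3 - x^2 + x - 1` and `g(x) = x^5 + x^4 + 2*x^3 + 2*x^2 + x + 1`
is an arithmetic subgroup of `O_Q(ℤ)`: it preserves `Q`, it is contained in `O_Q(ℤ)`,
and it has finite index in `O_Q(ℤ)`. -/
theorem hypergeometric_group_arithmetic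
    (A B : GL (Fin 5) ℤ)
    (hA : (A : Matrix (Fin 5) (Fin 5) ℤ) = matA)
    (hB : (B : Matrix (Fin 5) (Fin 5) ℤ) = matB) :
    matAᵀ * matQ * matA = matQ ∧
    matBᵀ * matQ * matB = matQ ∧
    Subgroup.closure {A, B} ≤ orthogonalSubgroup matQ ∧
    ((Subgroup.closure {A, B}).subgroupOf (orthogonalSubgroup matQ)).FiniteIndex := by
  have eA : matAᵀ * matQ * matA = matQ := by decide +kernel
  have eB : matBᵀ * matQ * matB = matQ := by decide +kernel
  refine ⟨eA, eB, ?_, ⟨HG.final_index hA hB⟩⟩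
  rw [Subgroup.closure_le]
  rintro g (rfl | rfl)
  · change (g : Matrix (Fin 5) (Fin 5) ℤ)ᵀ * matQ * (g : Matrix (Fin 5) (Fin 5) ℤ) = matQ
    rw [hA, eA]
  · change (g : Matrix (Fin 5) (Fin 5) ℤ)ᵀ * matQ * (g : Matrix (Fin 5) (Fin 5) ℤ) = matQ
    rw [hB, eB]
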